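/- Let u be a regular solution of the cubic–quintic NLS on an interval I ⊆ ℝ containing 0. If E(u(0,·)) = E^c(W) and ‖∇u(0,·)‖_{L²} < ‖∇W‖_{L²}, then ‖∇u(t,·)‖_{L²} < ‖∇W‖_{L²} for every t ∈ I. Similarly, if ‖∇u(0,·)‖_{L²} > ‖∇W‖_{L²}, then ‖∇u(t,·)‖_{L²} > ‖∇W‖_{L²} for every t ∈ I. -/

import Mathlib

open MeasureTheory Complex
open scoped BigOperators ENNReal

noncomputable section

abbrev E3 := EuclideanSpace ℝ (Fin 3)

/-- The Aubin–Talenti ground state `W(x) = (1 + |x|²/3)^(-1/2)`. -/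
def W (x : E3) : ℝ := (1 + ‖x‖ ^ 2 / 3) ^ (-(1 : ℝ) / 2)

/-- `W` viewed as a complex-valued function. -/
def Wc (x : E3) : ℂ := (W x : ℂ)

/-- Standard basis vectors of ℝ³. -/
def e3 (i : Fin 3) : E3 := EuclideanSpace.single i 1

/-- Partial derivative of a real-valued function. -/
def pdR (i : Fin 3) (f : E3 → ℝ) (x : E3) : ℝ := fderiv ℝ f x (e3 i)

/-- Partial derivative of a complex-valued function. -/
def pdC (i : Fin 3) (f : E3 → ℂ) (x : E3) : ℂ := fderiv ℝ f x (e3 i)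

/-- Squared gradient `|∇f|²` of a real-valued function. -/
def gradSqR (f : E3 → ℝ) (x : E3) : ℝ := ∑ i, (pdR i f x) ^ 2

/-- Squared gradient `|∇f|²` of a complex-valued function. -/
def gradSqC (f : E3 → ℂ) (x : E3) : ℝ := ∑ i, ‖pdC i f x‖ ^ 2

/-- Laplacian of a real-valued function. -/
def lapR (f : E3 → ℝ) (x : E3) : ℝ := ∑ i, pdR i (pdR i f) x

/-- Laplacian of a complex-valued function. -/
def lapC (f : E3 → ℂ) (x : E3) : ℂ := ∑ i, pdC i (pdC i f) x

/-- Quintic (energy-critical) energy `E^c`. -/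
def Ecrit (f : E3 → ℂ) : ℝ := ∫ x : E3, ((1:ℝ)/2 * gradSqC f x - 1/6 * ‖f x‖ ^ 6)

/-- Cubic–quintic energy `E`. -/
def Ecq (f : E3 → ℂ) : ℝ :=
  ∫ x : E3, ((1:ℝ)/2 * gradSqC f x - 1/6 * ‖f x‖ ^ 6 + 1/4 * ‖f x‖ ^ 4)

/-- Regular solutions of the cubic–quintic NLS on an interval `I ⊆ ℝ`. -/
def IsRegularSolution (I : Set ℝ) (u : ℝ → E3 → ℂ) : Prop :=
  ContDiffOn ℝ (⊤ : ℕ∞) (fun p : ℝ × E3 => u p.1 p.2) (I ×ˢ Set.univ) ∧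
  (∀ t ∈ I, ∀ x : E3, Complex.I * deriv (fun s => u s x) t + lapC (u t) x =
      (‖u t x‖ : ℂ) ^ 2 * u t x - (‖u t x‖ : ℂ) ^ 4 * u t x) ∧
  (∀ J : Set ℝ, IsCompact J → J ⊆ I → ∀ n k : ℕ, ∃ C : ℝ, ∀ t ∈ J, ∀ x : E3,
      (1 + ‖x‖) ^ n * ‖iteratedFDeriv ℝ k (u t) x‖ ≤ C)

open Filter Topology

lemma integral_Iic_props {p : ℝ → ℝ} (hc : Continuous p) (hp : ∀ x, 0 < p x)
    (hi : Integrable p) :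
    (∀ x, HasDerivAt (fun x => ∫ t in Set.Iic x, p t) (p x) x) ∧
    StrictMono (fun x => ∫ t in Set.Iic x, p t) ∧
    Tendsto (fun x => ∫ t in Set.Iic x, p t) atBot (𝓝 0) ∧
    Tendsto (fun x => ∫ t in Set.Iic x, p t) atTop (𝓝 (∫ t, p t)) := by
  have hd : ∀ x, HasDerivAt (fun x => ∫ t in Set.Iic x, p t) (p x) x := by
    intro x
    have h1 : (fun x => ∫ t in Set.Iic x, p t) =
        fun x => (∫ t in Set.Iic 0, p t) + ∫ t in (0 : ℝ)..x, p t := by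
      funext y
      rw [← intervalIntegral.integral_Iic_sub_Iic hi.integrableOn hi.integrableOn]
      ring
    rw [h1]
    exact (hc.integral_hasStrictDerivAt 0 x).hasDerivAt.const_add _
  refine ⟨hd, ?_, ?_, ?_⟩
  · apply strictMono_of_deriv_pos
    intro x
    rw [(hd x).deriv]
    exact hp x
  · have h2 : (fun x => ∫ t in Set.Iic x, p t) =
        fun x => (∫ t, p t) - ∫ t in Set.Ioi x, p t := by
      funext y
      have := integral_add_compl (measurableSet_Iic (a := y)) hi
      rw [Set.compl_Iic] at this
      linarith
    rw [h2]
    have := (aecover_Ioi (μ := (volume : Measure ℝ)) (l := atBot) (a := fun x : ℝ => x)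
      tendsto_id).integral_tendsto_of_countably_generated hi
    simpa using this.const_sub (∫ t, p t)
  · exact (aecover_Iic (μ := (volume : Measure ℝ)) (l := atTop) (b := fun x : ℝ => x)
      tendsto_id).integral_tendsto_of_countably_generated hi

/-- Monotone transport between two positive continuous densities of equal mass. -/
lemma exists_monotone_transport {p q : ℝ → ℝ} (hpc : Continuous p) (hqc : Continuous q)
    (hp : ∀ x, 0 < p x) (hq : ∀ x, 0 < q x) (hpi : Integrable p) (hqi : Integrable q)
    (hm : ∫ x, p x = ∫ x, q x) :
    ∃ T : ℝ → ℝ, StrictMono T ∧ Function.Surjective T ∧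
      ∀ x, HasDerivAt T (p x / q (T x)) x := by
  obtain ⟨hPd, hPm, hP0, hP1⟩ := integral_Iic_props hpc hp hpi
  obtain ⟨hQd, hQm, hQ0, hQ1⟩ := integral_Iic_props hqc hq hqi
  set P := fun x => ∫ t in Set.Iic x, p t
  set Q := fun x => ∫ t in Set.Iic x, q t
  have hPc : Continuous P := continuous_iff_continuousAt.2 fun x => (hPd x).continuousAt
  have hQc : Continuous Q := continuous_iff_continuousAt.2 fun x => (hQd x).continuousAt
  have key : ∀ {F G : ℝ → ℝ} (_ : StrictMono F) (_ : StrictMono G) (_ : Continuous G)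
      (_ : Tendsto F atBot (𝓝 0)) (_ : Tendsto F atTop (𝓝 (∫ x, p x)))
      (_ : Tendsto G atBot (𝓝 0)) (_ : Tendsto G atTop (𝓝 (∫ x, p x))) (x : ℝ),
      ∃ y, G y = F x := by
    intro F G hF hG hGc hF0 hF1 hG0 hG1 x
    have a1 : 0 < F x := lt_of_le_of_lt (hF.monotone.le_of_tendsto hF0 (x - 1))
      (hF (by linarith))
    have a2 : F x < ∫ x, p x := lt_of_lt_of_le (hF (show x < x + 1 by linarith))
      (hF.monotone.ge_of_tendsto hF1 (x + 1))
    obtain ⟨y1, h1⟩ := (hG0.eventually (gt_mem_nhds a1)).exists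
    obtain ⟨y2, h2⟩ := (hG1.eventually (lt_mem_nhds a2)).exists
    exact mem_range_of_exists_le_of_exists_ge hGc ⟨y1, h1.le⟩ ⟨y2, h2.le⟩
  have hQ1' : Tendsto Q atTop (𝓝 (∫ x, p x)) := hm ▸ hQ1
  choose T hT using key hPm hQm hQc hP0 hP1 hQ0 hQ1'
  choose S hS using key hQm hPm hPc hQ0 hQ1' hP0 hP1
  have hTS : ∀ y, T (S y) = y := fun y => hQm.injective (by rw [hT, hS])
  have hTm : StrictMono T := fun x y hxy => by
    rw [← hQm.lt_iff_lt, hT, hT]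
    exact hPm hxy
  have hsurj : Function.Surjective T := fun y => ⟨S y, hTS y⟩
  refine ⟨T, hTm, hsurj, fun x => ?_⟩
  have hTc : Continuous T := hTm.monotone.continuous_of_surjective hsurj
  have hloc := (hqc.stronglyMeasurableAtFilter volume (𝓝 (T x)))
  set R := Function.invFun Q
  have hRQ : ∀ y, R (Q y) = y := Function.leftInverse_invFun hQm.injective
  have hR : HasDerivAt R (q (T x))⁻¹ (Q (T x)) := by
    have hran : Set.range Q ∈ 𝓝 (Q (T x)) := by
      have e1 : Set.Icc (Q (T x - 1)) (Q (T x + 1)) ⊆ Set.range Q := by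
        intro z hz
        exact mem_range_of_exists_le_of_exists_ge hQc ⟨_, hz.1⟩ ⟨_, hz.2⟩
      exact mem_of_superset (Icc_mem_nhds (hQm (by linarith)) (hQm (by linarith))) e1
    apply HasDerivAt.of_local_left_inverse (f := Q)
    · apply StrictMonoOn.continuousAt_of_image_mem_nhds (s := Set.range Q) _ hran
      · rw [← Set.range_comp]
        have : R ∘ Q = id := funext hRQ
        simp [this]
      · rintro _ ⟨a, rfl⟩ _ ⟨b, rfl⟩ hab
        rw [hRQ, hRQ]
        exact hQm.lt_iff_lt.1 hab
    · rw [hRQ]; exact hQd _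
    · exact (hq _).ne'
    · filter_upwards [hran]
      rintro _ ⟨a, rfl⟩
      rw [hRQ]
  have hcomp : T = R ∘ P := by
    funext z
    simp only [Function.comp, ← hT z, hRQ]
  rw [hT] at hR
  have := hR.comp x (hPd x)
  rw [← hcomp] at this
  rw [div_eq_inv_mul]
  exact this

/-- Change of variables along a monotone surjective transport. -/
lemma lintegral_transport {T T' : ℝ → ℝ} (hm : StrictMono T) (hs : Function.Surjective T)
    (hd : ∀ x, HasDerivAt T (T' x) x) (hpos : ∀ x, 0 ≤ T' x) (F : ℝ → ℝ≥0∞) :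
    ∫⁻ x, ENNReal.ofReal (T' x) * F (T x) = ∫⁻ y, F y := by
  have := lintegral_image_eq_lintegral_abs_deriv_mul MeasurableSet.univ
    (fun x _ => (hd x).hasDerivWithinAt) hm.injective.injOn F
  rw [Set.image_univ, hs.range_eq] at this
  simpa [abs_of_nonneg (hpos _)] using this.symm

/-- One-dimensional integration by parts against an increasing function: no decay of the
increasing function is needed. -/
lemma lintegral_mul_deriv_le {w w' T T' : ℝ → ℝ} (hw : ∀ x, HasDerivAt w (w' x) x)
    (hw' : Continuous w') (hw0 : ∀ x, 0 ≤ w x) (hbot : Tendsto w atBot (𝓝 0))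
    (htop : Tendsto w atTop (𝓝 0)) (hT : ∀ x, HasDerivAt T (T' x) x) (hT' : Continuous T')
    (hT0 : ∀ x, 0 ≤ T' x) :
    ∫⁻ x, ENNReal.ofReal (w x * T' x) ≤ ∫⁻ x, ENNReal.ofReal (|w' x| * |T x|) := by
  by_cases hfin : ∫⁻ x, ENNReal.ofReal (|w' x| * |T x|) = ∞
  · rw [hfin]; exact le_top
  have hwc : Continuous w := continuous_iff_continuousAt.2 fun x => (hw x).continuousAt
  have hTc : Continuous T := continuous_iff_continuousAt.2 fun x => (hT x).continuousAt
  have hmono : Monotone T := monotone_of_deriv_nonneg (fun x => (hT x).differentiableAt)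
    (fun x => by rw [(hT x).deriv]; exact hT0 x)
  have hgc : Continuous fun x => |w' x| * |T x| := by fun_prop
  have hgi : Integrable fun x => |w' x| * |T x| := by
    refine ⟨hgc.aestronglyMeasurable, ?_⟩
    rw [hasFiniteIntegral_iff_ofReal (Eventually.of_forall fun x => by positivity)]
    exact lt_top_iff_ne_top.2 hfin
  rw [← ofReal_integral_eq_lintegral_ofReal hgi (Eventually.of_forall fun x => by positivity)]
  set A := ∫ x, |w' x| * |T x| with hA
  have hbound : ∀ a b, a ≤ b → ∫ x in a..b, |w' x| * |T x| ≤ A := by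
    intro a b hab
    rw [intervalIntegral.integral_of_le hab]
    exact setIntegral_le_integral hgi (Eventually.of_forall fun x => by positivity)
  have hright : ∀ R R', R ≤ R' → w R * T R ≤ (∫ x in R..R', |w' x| * |T x|) + w R' * |T R| := by
    intro R R' hRR
    rcases le_or_gt (T R) 0 with hneg | hpos
    · have h1 : w R * T R ≤ 0 := mul_nonpos_of_nonneg_of_nonpos (hw0 _) hneg
      have h2 : 0 ≤ ∫ x in R..R', |w' x| * |T x| :=
        intervalIntegral.integral_nonneg hRR fun x _ => by positivity
      have h3 := mul_nonneg (hw0 R') (abs_nonneg (T R))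
      linarith
    · have e : ∫ x in R..R', w' x = w R' - w R :=
        intervalIntegral.integral_eq_sub_of_hasDerivAt (fun x _ => hw x)
          (hw'.intervalIntegrable _ _)
      have h1 : ∫ x in R..R', -w' x * T R ≤ ∫ x in R..R', |w' x| * |T x| := by
        apply intervalIntegral.integral_mono_on hRR
          (Continuous.intervalIntegrable (by fun_prop) _ _) (hgc.intervalIntegrable _ _)
        intro x hx
        have hTx : T R ≤ |T x| := (hmono hx.1).trans (le_abs_self _)
        exact mul_le_mul (neg_le_abs _) hTx hpos.le (abs_nonneg _)
      rw [intervalIntegral.integral_mul_const, intervalIntegral.integral_neg, e] at h1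
      rw [abs_of_pos hpos]
      linarith
  have hleft : ∀ R R', R' ≤ R → -(w R * T R) ≤ (∫ x in R'..R, |w' x| * |T x|) + w R' * |T R| := by
    intro R R' hRR
    rcases le_or_gt 0 (T R) with hneg | hpos
    · have h1 : 0 ≤ w R * T R := mul_nonneg (hw0 _) hneg
      have h2 : 0 ≤ ∫ x in R'..R, |w' x| * |T x| :=
        intervalIntegral.integral_nonneg hRR fun x _ => by positivity
      have h3 := mul_nonneg (hw0 R') (abs_nonneg (T R))
      linarith
    · have e : ∫ x in R'..R, w' x = w R - w R' :=
        intervalIntegral.integral_eq_sub_of_hasDerivAt (fun x _ => hw x)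
          (hw'.intervalIntegrable _ _)
      have h1 : ∫ x in R'..R, w' x * (-T R) ≤ ∫ x in R'..R, |w' x| * |T x| := by
        apply intervalIntegral.integral_mono_on hRR
          (Continuous.intervalIntegrable (by fun_prop) _ _) (hgc.intervalIntegrable _ _)
        intro x hx
        have hTx : -T R ≤ |T x| := (neg_le_neg (hmono hx.2)).trans (neg_le_abs _)
        exact mul_le_mul (le_abs_self _) hTx (by linarith) (abs_nonneg _)
      rw [intervalIntegral.integral_mul_const, e] at h1
      rw [abs_of_neg hpos]
      linarith
  have hbd : ∀ R, 0 ≤ R → ∫ x in (-R)..R, w x * T' x ≤ A := by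
    intro R hR
    have hR' : ∀ᶠ R' in atTop, ∫ x in (-R)..R, w x * T' x ≤
        A + w R' * |T R| + w (-R') * |T (-R)| := by
      filter_upwards [eventually_ge_atTop R] with R' hRR
      have e : ∫ x in (-R)..R, (w' x * T x + w x * T' x) = w R * T R - w (-R) * T (-R) :=
        intervalIntegral.integral_eq_sub_of_hasDerivAt (fun x _ => (hw x).mul (hT x))
          (Continuous.intervalIntegrable (by fun_prop) _ _)
      rw [intervalIntegral.integral_add (Continuous.intervalIntegrable (by fun_prop) _ _)
        (Continuous.intervalIntegrable (by fun_prop) _ _)] at e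
      have h1 : -(∫ x in (-R)..R, w' x * T x) ≤ ∫ x in (-R)..R, |w' x| * |T x| := by
        rw [← intervalIntegral.integral_neg]
        apply intervalIntegral.integral_mono_on (by linarith)
          (Continuous.intervalIntegrable (by fun_prop) _ _) (hgc.intervalIntegrable _ _)
        intro x _
        rw [← abs_mul]
        exact neg_le_abs _
      have h2 := hright R R' hRR
      have h3 := hleft (-R) (-R') (by linarith)
      have h4 := hbound (-R') R' (by linarith)
      have i1 := intervalIntegral.integral_add_adjacent_intervals
        (hgc.intervalIntegrable (μ := volume) (-R') (-R)) (hgc.intervalIntegrable (-R) R)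
      have i2 := intervalIntegral.integral_add_adjacent_intervals
        (hgc.intervalIntegrable (μ := volume) (-R') R) (hgc.intervalIntegrable R R')
      linarith
    have hlim : Tendsto (fun R' => A + w R' * |T R| + w (-R') * |T (-R)|) atTop (𝓝 A) := by
      have := ((htop.mul_const |T R|).const_add A).add
        ((hbot.comp tendsto_neg_atTop_atBot).mul_const |T (-R)|)
      simpa using this
    exact ge_of_tendsto hlim hR'
  have hlim := (aecover_Icc (μ := (volume : Measure ℝ)) (l := (atTop : Filter ℕ))
    (a := fun n : ℕ => -(n : ℝ)) (b := fun n : ℕ => (n : ℝ))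
    (tendsto_neg_atTop_atBot.comp tendsto_natCast_atTop_atTop)
    tendsto_natCast_atTop_atTop).lintegral_tendsto_of_countably_generated
    (f := fun x => ENNReal.ofReal (w x * T' x))
    (by have : Continuous fun x => w x * T' x := by fun_prop
        exact this.measurable.ennreal_ofReal.aemeasurable)
  refine le_of_tendsto hlim (Eventually.of_forall fun n => ?_)
  have hn : (0 : ℝ) ≤ n := n.cast_nonneg
  have hc : Continuous fun x => w x * T' x := by fun_prop
  rw [← ofReal_integral_eq_lintegral_ofReal (hc.integrableOn_Icc)
    (Eventually.of_forall fun x => mul_nonneg (hw0 x) (hT0 x)), integral_Icc_eq_integral_Ioc,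
    ← intervalIntegral.integral_of_le (by linarith)]
  exact ENNReal.ofReal_le_ofReal (hbd n hn)

/-- The weight controlling densities along coordinate lines. -/
def lineWeight (x : ℝ) : ℝ := (1 + x ^ 2 / 3)⁻¹

lemma lineWeight_pos (x : ℝ) : 0 < lineWeight x := by unfold lineWeight; positivity

lemma lineWeight_le_one (x : ℝ) : lineWeight x ≤ 1 := by
  unfold lineWeight
  exact inv_le_one_of_one_le₀ (by nlinarith [sq_nonneg x])

lemma integrable_lineWeight : Integrable lineWeight := by
  have h : Integrable fun x : ℝ => 3 * (1 + x ^ 2)⁻¹ := integrable_inv_one_add_sq.const_mul 3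
  refine h.mono' ?_ (Eventually.of_forall fun x => ?_)
  · have : Continuous lineWeight := by
      unfold lineWeight
      exact Continuous.inv₀ (by fun_prop) fun x => by positivity
    exact this.aestronglyMeasurable
  · rw [Real.norm_of_nonneg (lineWeight_pos x).le]
    unfold lineWeight
    rw [← div_eq_mul_inv, inv_eq_one_div, div_le_div_iff₀ (by positivity) (by positivity)]
    nlinarith [sq_nonneg x]

lemma tendsto_lineWeight_atTop : Tendsto lineWeight atTop (𝓝 0) := by
  unfold lineWeight
  apply Tendsto.inv_tendsto_atTop
  apply tendsto_atTop_add_const_left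
  exact (tendsto_pow_atTop (two_ne_zero)).atTop_div_const (by norm_num)

lemma tendsto_lineWeight_atBot : Tendsto lineWeight atBot (𝓝 0) := by
  have := tendsto_lineWeight_atTop.comp tendsto_neg_atBot_atTop
  refine this.congr fun x => ?_
  simp [lineWeight]

lemma tendsto_zero_of_pow_le_lineWeight {l : Filter ℝ} {w : ℝ → ℝ} {C : ℝ} (h0 : ∀ x, 0 ≤ w x)
    (hk : Tendsto lineWeight l (𝓝 0)) (h : ∀ x, w x ^ 6 ≤ C * lineWeight x) :
    Tendsto w l (𝓝 0) := by
  have h1 : Tendsto (fun x => w x ^ 6) l (𝓝 0) := by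
    refine squeeze_zero (fun x => by have := h0 x; positivity) h ?_
    simpa using hk.const_mul C
  have h2 := (Real.continuousAt_rpow_const 0 (1 / 6 : ℝ) (Or.inr (by norm_num))).tendsto.comp h1
  have h3 : ((0 : ℝ) ^ (1 / 6 : ℝ)) = 0 := Real.zero_rpow (by norm_num)
  rw [h3] at h2
  refine h2.congr fun x => ?_
  simp only [Function.comp]
  rw [← Real.rpow_natCast, ← Real.rpow_mul (h0 x)]
  norm_num

lemma marginal_props {X : Type*} [TopologicalSpace X] [FirstCountableTopology X]
    {F : X → ℝ → ℝ} {C : ℝ} (hF : Continuous (Function.uncurry F)) (hpos : ∀ x c, 0 < F x c)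
    (hC : ∀ x c, F x c ≤ C * lineWeight c) :
    Continuous (fun x => ∫ c, F x c) ∧ (∀ x, 0 < ∫ c, F x c) ∧ ∀ x, Integrable (F x) := by
  have hcont : ∀ x, Continuous (F x) := fun x => hF.comp (by fun_prop : Continuous fun c => (x, c))
  have hi : ∀ x, Integrable (F x) := fun x =>
    (integrable_lineWeight.const_mul C).mono' (hcont x).aestronglyMeasurable
      (Eventually.of_forall fun c => by
        rw [Real.norm_of_nonneg (hpos x c).le]; exact hC x c)
  refine ⟨?_, fun x => ?_, hi⟩
  · apply continuous_of_dominated (bound := fun c => C * lineWeight c)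
    · exact fun x => (hcont x).aestronglyMeasurable
    · exact fun x => Eventually.of_forall fun c => by
        rw [Real.norm_of_nonneg (hpos x c).le]; exact hC x c
    · exact integrable_lineWeight.const_mul C
    · exact Eventually.of_forall fun c => hF.comp (by fun_prop : Continuous fun x => (x, c))
  · exact integral_pos_of_integrable_nonneg_nonzero (x := 0) (hcont x) (hi x)
      (fun c => (hpos x c).le) (hpos x 0).ne'

lemma lintegral_eq_ofReal_integral {α : Type*} [MeasureSpace α] {f : α → ℝ}
    (hi : Integrable f) (h : ∀ x, 0 ≤ f x) :
    ∫⁻ x, ENNReal.ofReal (f x) = ENNReal.ofReal (∫ x, f x) :=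
  (ofReal_integral_eq_lintegral_ofReal hi (Eventually.of_forall h)).symm

/-- The transport boundary term, integrated over a parameter space. -/
lemma lintegral_transport_slice {Z : Type*} [TopologicalSpace Z] [SecondCountableTopology Z]
    [MeasurableSpace Z] [BorelSpace Z] (ν : Measure Z) [SFinite ν] {v dv : ℝ → Z → ℝ}
    {T T' : ℝ → ℝ}
    (hv : Continuous (Function.uncurry v)) (hdv : Continuous (Function.uncurry dv))
    (hd : ∀ b z, HasDerivAt (fun s => v s z) (dv b z) b) (h0 : ∀ b z, 0 ≤ v b z)
    (hbot : ∀ z, Tendsto (fun s => v s z) atBot (𝓝 0))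
    (htop : ∀ z, Tendsto (fun s => v s z) atTop (𝓝 0))
    (hT : ∀ x, HasDerivAt T (T' x) x) (hT' : Continuous T') (hT0 : ∀ x, 0 ≤ T' x) :
    3 * ∫⁻ b, ENNReal.ofReal (T' b) * ∫⁻ z, ENNReal.ofReal (v b z ^ 4) ∂ν ≤
      18 * (∫⁻ b, ∫⁻ z, ENNReal.ofReal (dv b z ^ 2) ∂ν) +
      2 * ∫⁻ b, ENNReal.ofReal (T b ^ 2) * ∫⁻ z, ENNReal.ofReal (v b z ^ 6) ∂ν := by
  have hTc : Continuous T := continuous_iff_continuousAt.2 fun x => (hT x).continuousAt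
  have hv' : Continuous fun p : ℝ × Z => v p.1 p.2 := hv
  have hdv' : Continuous fun p : ℝ × Z => dv p.1 p.2 := hdv
  have e1 : ∀ b, ENNReal.ofReal (T' b) * ∫⁻ z, ENNReal.ofReal (v b z ^ 4) ∂ν =
      ∫⁻ z, ENNReal.ofReal (v b z ^ 4 * T' b) ∂ν := fun b => by
    rw [← lintegral_const_mul' _ _ ENNReal.ofReal_ne_top]
    refine lintegral_congr fun z => ?_
    rw [mul_comm, ENNReal.ofReal_mul (by have := h0 b z; positivity)]
  have e2 : ∀ b, ENNReal.ofReal (T b ^ 2) * ∫⁻ z, ENNReal.ofReal (v b z ^ 6) ∂ν =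
      ∫⁻ z, ENNReal.ofReal (T b ^ 2 * v b z ^ 6) ∂ν := fun b => by
    rw [← lintegral_const_mul' _ _ ENNReal.ofReal_ne_top]
    refine lintegral_congr fun z => ?_
    rw [ENNReal.ofReal_mul (by positivity)]
  simp only [e1, e2]
  have m1 : Measurable fun p : ℝ × Z => ENNReal.ofReal (v p.1 p.2 ^ 4 * T' p.1) :=
    (Continuous.measurable (by fun_prop)).ennreal_ofReal
  have m2 : Measurable fun p : ℝ × Z => ENNReal.ofReal (dv p.1 p.2 ^ 2) :=
    (Continuous.measurable (by fun_prop)).ennreal_ofReal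
  have m3 : Measurable fun p : ℝ × Z => ENNReal.ofReal (T p.1 ^ 2 * v p.1 p.2 ^ 6) :=
    (Continuous.measurable (by fun_prop)).ennreal_ofReal
  rw [lintegral_lintegral_swap (f := fun b z => ENNReal.ofReal (v b z ^ 4 * T' b)) m1.aemeasurable,
    lintegral_lintegral_swap (f := fun b z => ENNReal.ofReal (dv b z ^ 2)) m2.aemeasurable,
    lintegral_lintegral_swap (f := fun b z => ENNReal.ofReal (T b ^ 2 * v b z ^ 6))
      m3.aemeasurable]
  have n1 : Measurable fun z => ∫⁻ b, ENNReal.ofReal (v b z ^ 4 * T' b) := m1.lintegral_prod_left'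
  have n2 : Measurable fun z => ∫⁻ b, ENNReal.ofReal (dv b z ^ 2) := m2.lintegral_prod_left'
  have n3 : Measurable fun z => ∫⁻ b, ENNReal.ofReal (T b ^ 2 * v b z ^ 6) :=
    m3.lintegral_prod_left'
  rw [← lintegral_const_mul _ n1, ← lintegral_const_mul _ n2, ← lintegral_const_mul _ n3,
    ← lintegral_add_left (n2.const_mul _)]
  refine lintegral_mono fun z => ?_
  have c1 : Continuous fun b => v b z := hv.comp (by fun_prop : Continuous fun b => (b, z))
  have c2 : Continuous fun b => dv b z := hdv.comp (by fun_prop : Continuous fun b => (b, z))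
  have key := lintegral_mul_deriv_le (w := fun b => v b z ^ 4)
    (w' := fun b => 4 * v b z ^ 3 * dv b z) (T := T) (T' := T')
    (fun b => by simpa using (hd b z).fun_pow 4) (by fun_prop)
    (fun b => by have := h0 b z; positivity)
    (by simpa using (hbot z).pow 4) (by simpa using (htop z).pow 4) hT hT' hT0
  have m4 : Measurable fun b => ENNReal.ofReal (dv b z ^ 2) :=
    (Continuous.measurable (by fun_prop)).ennreal_ofReal
  have m5 : Measurable fun b => ENNReal.ofReal (T b ^ 2 * v b z ^ 6) :=
    (Continuous.measurable (by fun_prop)).ennreal_ofReal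
  have m6 : Measurable fun b => ENNReal.ofReal (|4 * v b z ^ 3 * dv b z| * |T b|) :=
    (Continuous.measurable (by fun_prop)).ennreal_ofReal
  refine (mul_le_mul_right key 3).trans ?_
  rw [← lintegral_const_mul _ m4, ← lintegral_const_mul _ m5, ← lintegral_const_mul _ m6,
    ← lintegral_add_left (m4.const_mul _)]
  refine lintegral_mono fun b => ?_
  have k3 : (3 : ℝ≥0∞) = ENNReal.ofReal 3 := by simp
  have k18 : (18 : ℝ≥0∞) = ENNReal.ofReal 18 := by simp
  have k2 : (2 : ℝ≥0∞) = ENNReal.ofReal 2 := by simp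
  simp only []
  rw [k3, k18, k2, ← ENNReal.ofReal_mul (by norm_num), ← ENNReal.ofReal_mul (by norm_num),
    ← ENNReal.ofReal_mul (by norm_num),
    ← ENNReal.ofReal_add (by positivity) (by have := h0 b z; positivity)]
  apply ENNReal.ofReal_le_ofReal
  rw [abs_mul, abs_mul, abs_of_nonneg (by norm_num : (0 : ℝ) ≤ 4),
    abs_of_nonneg (pow_nonneg (h0 b z) 3), ← sq_abs (T b), ← sq_abs (dv b z)]
  nlinarith [sq_nonneg (3 * |dv b z| - v b z ^ 3 * |T b|)]

lemma le_arith_mean_of_cube_eq {a b c s : ℝ} (ha : 0 ≤ a) (hb : 0 ≤ b) (hc : 0 ≤ c)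
    (h : a * b * c = s ^ 3) : 3 * s ≤ a + b + c := by
  by_contra! hlt
  have h1 : (a + b + c) ^ 3 < (3 * s) ^ 3 := pow_lt_pow_left₀ hlt (by positivity) (by norm_num)
  nlinarith [mul_nonneg ha (sq_nonneg (b - c)), mul_nonneg hb (sq_nonneg (a - c)),
    mul_nonneg hc (sq_nonneg (a - b)), mul_nonneg (add_nonneg (add_nonneg ha hb) hc)
      (add_nonneg (add_nonneg (sq_nonneg (a - b)) (sq_nonneg (b - c))) (sq_nonneg (a - c)))]

/-- Transport inequality on a line, given the stretching factors `α`, `β` of the two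
transverse directions. -/
lemma transport_ineq_line {v dv g : ℝ → ℝ} {α β C : ℝ} (hα : 0 < α) (hβ : 0 < β)
    (hdv : Continuous dv) (hg : Continuous g)
    (hd : ∀ c, HasDerivAt v (dv c) c) (hv0 : ∀ c, 0 < v c) (hg0 : ∀ c, 0 < g c)
    (hvC : ∀ c, v c ^ 6 ≤ C * lineWeight c) (hgC : ∀ c, g c ^ 6 ≤ C * lineWeight c)
    (hm : ∫ c, v c ^ 6 = α * β * ∫ c, g c ^ 6) :
    9 * (ENNReal.ofReal (α * β) * ∫⁻ s, ENNReal.ofReal (g s ^ 4)) ≤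
      3 * ((ENNReal.ofReal α + ENNReal.ofReal β) * ∫⁻ c, ENNReal.ofReal (v c ^ 4)) +
      18 * (∫⁻ c, ENNReal.ofReal (dv c ^ 2)) +
      2 * (ENNReal.ofReal (α * β) * ∫⁻ s, ENNReal.ofReal (s ^ 2 * g s ^ 6)) := by
  have hv : Continuous v := continuous_iff_continuousAt.2 fun x => (hd x).continuousAt
  have hαβ : 0 < α * β := mul_pos hα hβ
  have hvi := (marginal_props (X := Unit) (F := fun _ c => v c ^ 6) (C := C) (by
    simp only [Function.uncurry_def]; fun_prop) (fun _ c => pow_pos (hv0 c) 6)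
    (fun _ c => hvC c)).2.2 ()
  have hgi := (marginal_props (X := Unit) (F := fun _ c => g c ^ 6) (C := C) (by
    simp only [Function.uncurry_def]; fun_prop) (fun _ c => pow_pos (hg0 c) 6)
    (fun _ c => hgC c)).2.2 ()
  obtain ⟨T, hTm, hTs, hTd⟩ := exists_monotone_transport (p := fun c => v c ^ 6)
    (q := fun c => α * β * g c ^ 6) (by fun_prop) (by fun_prop) (fun c => pow_pos (hv0 c) 6)
    (fun c => mul_pos hαβ (pow_pos (hg0 c) 6)) hvi (hgi.const_mul _)
    (by rw [hm, integral_const_mul])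
  set T' : ℝ → ℝ := fun x => v x ^ 6 / (α * β * g (T x) ^ 6) with hT'
  have hTc : Continuous T := continuous_iff_continuousAt.2 fun x => (hTd x).continuousAt
  have hT'c : Continuous T' := by
    refine Continuous.div (by fun_prop) (by fun_prop) fun x => ?_
    exact (mul_pos hαβ (pow_pos (hg0 _) 6)).ne'
  have hT'0 : ∀ x, 0 < T' x := fun x =>
    div_pos (pow_pos (hv0 x) 6) (mul_pos hαβ (pow_pos (hg0 _) 6))
  have hslice := lintegral_transport_slice (Z := Unit) (Measure.dirac ()) (v := fun c _ => v c)
    (dv := fun c _ => dv c) (T := T) (T' := T') (by simp only [Function.uncurry_def]; fun_prop)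
    (by simp only [Function.uncurry_def]; fun_prop)
    (fun b _ => hd b) (fun b _ => (hv0 b).le)
    (fun _ => tendsto_zero_of_pow_le_lineWeight (fun c => (hv0 c).le) tendsto_lineWeight_atBot hvC)
    (fun _ => tendsto_zero_of_pow_le_lineWeight (fun c => (hv0 c).le) tendsto_lineWeight_atTop hvC)
    hTd hT'c (fun x => (hT'0 x).le)
  simp only [lintegral_dirac] at hslice
  have t1 := lintegral_transport hTm hTs hTd (fun x => (hT'0 x).le)
    (fun s => ENNReal.ofReal (g s ^ 4))
  have t2 := lintegral_transport hTm hTs hTd (fun x => (hT'0 x).le)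
    (fun s => ENNReal.ofReal (s ^ 2 * g s ^ 6))
  have e2 : ENNReal.ofReal (α * β) * ∫⁻ s, ENNReal.ofReal (s ^ 2 * g s ^ 6) =
      ∫⁻ b, ENNReal.ofReal (T b ^ 2) * ENNReal.ofReal (v b ^ 6) := by
    rw [← t2, ← lintegral_const_mul' _ _ ENNReal.ofReal_ne_top]
    refine lintegral_congr fun x => ?_
    have := hg0 (T x)
    have := hT'0 x
    rw [← ENNReal.ofReal_mul (by positivity), ← ENNReal.ofReal_mul (by positivity),
      ← ENNReal.ofReal_mul (by positivity)]
    congr 1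
    field_simp
  have mv : Measurable fun c => ENNReal.ofReal (v c ^ 4) :=
    (Continuous.measurable (by fun_prop)).ennreal_ofReal
  have e1 : 9 * (ENNReal.ofReal (α * β) * ∫⁻ s, ENNReal.ofReal (g s ^ 4)) ≤
      3 * ((ENNReal.ofReal α + ENNReal.ofReal β) * ∫⁻ c, ENNReal.ofReal (v c ^ 4)) +
      3 * ∫⁻ b, ENNReal.ofReal (T' b) * ENNReal.ofReal (v b ^ 4) := by
    rw [← t1, ← lintegral_const_mul' _ _ ENNReal.ofReal_ne_top,
      ← ENNReal.ofReal_add hα.le hβ.le,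
      ← lintegral_const_mul' _ _ ENNReal.ofReal_ne_top, ← mul_add,
      ← lintegral_add_left (mv.const_mul _)]
    have k9 : (9 : ℝ≥0∞) = 3 * 3 := by norm_num
    rw [k9, mul_assoc]
    refine mul_le_mul_right ?_ 3
    rw [← lintegral_const_mul' _ _ (by simp)]
    refine lintegral_mono fun x => ?_
    have hg1 := hg0 (T x)
    have hT1 := hT'0 x
    have hv1 := hv0 x
    have k3 : (3 : ℝ≥0∞) = ENNReal.ofReal 3 := by simp
    simp only []
    rw [k3, ← ENNReal.ofReal_mul (by positivity), ← ENNReal.ofReal_mul (by positivity),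
      ← ENNReal.ofReal_mul (by positivity), ← ENNReal.ofReal_mul (by positivity),
      ← ENNReal.ofReal_mul (by positivity),
      ← ENNReal.ofReal_add (by positivity) (by positivity)]
    apply ENNReal.ofReal_le_ofReal
    have hcube : α * β * T' x = ((v x / g (T x)) ^ 2) ^ 3 := by
      change α * β * (v x ^ 6 / (α * β * g (T x) ^ 6)) = _
      field_simp
    have hamgm := le_arith_mean_of_cube_eq hα.le hβ.le hT1.le hcube
    have e3 : α * β * (T' x * g (T x) ^ 4) = v x ^ 4 * (v x / g (T x)) ^ 2 := by
      rw [← mul_assoc, hcube]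
      field_simp
    rw [e3]
    nlinarith [mul_le_mul_of_nonneg_left hamgm (pow_pos hv1 4).le]
  rw [e2]
  refine e1.trans ?_
  rw [add_assoc]
  gcongr

/-- Transport inequality on a plane, given the stretching factor `α` of the transverse
direction. -/
lemma transport_ineq_plane {v d1 d2 g : ℝ → ℝ → ℝ} {α C : ℝ} (hα : 0 < α)
    (hv : Continuous (Function.uncurry v)) (hd1 : Continuous (Function.uncurry d1))
    (hd2 : Continuous (Function.uncurry d2)) (hg : Continuous (Function.uncurry g))
    (h1 : ∀ b c, HasDerivAt (fun s => v s c) (d1 b c) b)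
    (h2 : ∀ b c, HasDerivAt (fun s => v b s) (d2 b c) c)
    (hv0 : ∀ b c, 0 < v b c) (hg0 : ∀ b c, 0 < g b c)
    (hvC : ∀ b c, v b c ^ 6 ≤ C * (lineWeight b * lineWeight c))
    (hgC : ∀ b c, g b c ^ 6 ≤ C * (lineWeight b * lineWeight c))
    (hm : ∫ b, ∫ c, v b c ^ 6 = α * ∫ b, ∫ c, g b c ^ 6) :
    9 * (ENNReal.ofReal α * ∫⁻ s, ∫⁻ t, ENNReal.ofReal (g s t ^ 4)) ≤
      3 * (ENNReal.ofReal α * ∫⁻ b, ∫⁻ c, ENNReal.ofReal (v b c ^ 4)) +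
      18 * ((∫⁻ b, ∫⁻ c, ENNReal.ofReal (d1 b c ^ 2)) +
        ∫⁻ b, ∫⁻ c, ENNReal.ofReal (d2 b c ^ 2)) +
      2 * (ENNReal.ofReal α * ((∫⁻ s, ∫⁻ t, ENNReal.ofReal (s ^ 2 * g s t ^ 6)) +
        ∫⁻ s, ∫⁻ t, ENNReal.ofReal (t ^ 2 * g s t ^ 6))) := by
  have hv' : Continuous fun p : ℝ × ℝ => v p.1 p.2 := hv
  have hd1' : Continuous fun p : ℝ × ℝ => d1 p.1 p.2 := hd1
  have hd2' : Continuous fun p : ℝ × ℝ => d2 p.1 p.2 := hd2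
  have hg' : Continuous fun p : ℝ × ℝ => g p.1 p.2 := hg
  have hC : 0 ≤ C := by
    have := (pow_pos (hv0 0 0) 6).trans_le (hvC 0 0)
    exact (pos_of_mul_pos_left this (mul_pos (lineWeight_pos 0) (lineWeight_pos 0)).le).le
  have hk : ∀ b c, C * (lineWeight b * lineWeight c) ≤ C * lineWeight c := fun b c =>
    mul_le_mul_of_nonneg_left
      (mul_le_of_le_one_left (lineWeight_pos c).le (lineWeight_le_one b)) hC
  have hk' : ∀ b c, C * (lineWeight b * lineWeight c) ≤ C * lineWeight b := fun b c =>
    mul_le_mul_of_nonneg_left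
      (mul_le_of_le_one_right (lineWeight_pos b).le (lineWeight_le_one c)) hC
  have marg : ∀ {h : ℝ → ℝ → ℝ}, Continuous (Function.uncurry h) → (∀ b c, 0 < h b c) →
      (∀ b c, h b c ^ 6 ≤ C * (lineWeight b * lineWeight c)) →
      Continuous (fun b => ∫ c, h b c ^ 6) ∧ (∀ b, 0 < ∫ c, h b c ^ 6) ∧
      (∀ b, Integrable fun c => h b c ^ 6) ∧ Integrable (fun b => ∫ c, h b c ^ 6) := by
    intro h hh hh0 hhC
    have hh' : Continuous fun p : ℝ × ℝ => h p.1 p.2 := hh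
    obtain ⟨m1, m2, m3⟩ := marginal_props (F := fun b c => h b c ^ 6) (C := C)
      (by simp only [Function.uncurry_def]; fun_prop) (fun b c => pow_pos (hh0 b c) 6)
      (fun b c => (hhC b c).trans (hk b c))
    refine ⟨m1, m2, m3, ?_⟩
    refine (integrable_lineWeight.const_mul (C * ∫ c, lineWeight c)).mono'
      m1.aestronglyMeasurable (Eventually.of_forall fun b => ?_)
    rw [Real.norm_of_nonneg (m2 b).le]
    calc ∫ c, h b c ^ 6 ≤ ∫ c, C * (lineWeight b * lineWeight c) :=
          integral_mono (m3 b) ((integrable_lineWeight.const_mul _).const_mul _) (hhC b)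
      _ = _ := by rw [integral_const_mul, integral_const_mul]; ring
  obtain ⟨Hc, H0, Hi', Hi⟩ := marg hv hv0 hvC
  obtain ⟨Gc, G0, Gi', Gi⟩ := marg hg hg0 hgC
  set H : ℝ → ℝ := fun b => ∫ c, v b c ^ 6 with hH
  set G : ℝ → ℝ := fun b => ∫ c, g b c ^ 6 with hG
  obtain ⟨T, hTm, hTs, hTd⟩ := exists_monotone_transport (p := H)
    (q := fun s => α * G s) Hc (by fun_prop) H0
    (fun c => mul_pos hα (G0 c)) Hi (Gi.const_mul _)
    (by rw [hm, integral_const_mul])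
  set T' : ℝ → ℝ := fun x => H x / (α * G (T x)) with hT'
  have hTc : Continuous T := continuous_iff_continuousAt.2 fun x => (hTd x).continuousAt
  have hT'c : Continuous T' := by
    refine Continuous.div (by fun_prop) (by fun_prop) fun x => ?_
    exact (mul_pos hα (G0 _)).ne'
  have hT'0 : ∀ x, 0 < T' x := fun x => div_pos (H0 x) (mul_pos hα (G0 _))
  have hTH : ∀ x, H x = α * T' x * G (T x) := fun x => by
    have : G (T x) ≠ 0 := (G0 (T x)).ne'
    rw [hT']
    field_simp
  have hslice := lintegral_transport_slice (Z := ℝ) volume (v := v)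
    (dv := d1) (T := T) (T' := T') hv hd1 h1 (fun b c => (hv0 b c).le)
    (fun c => tendsto_zero_of_pow_le_lineWeight (fun b => (hv0 b c).le) tendsto_lineWeight_atBot
      fun b => (hvC b c).trans (hk' b c))
    (fun c => tendsto_zero_of_pow_le_lineWeight (fun b => (hv0 b c).le) tendsto_lineWeight_atTop
      fun b => (hvC b c).trans (hk' b c))
    hTd hT'c (fun x => (hT'0 x).le)
  have line : ∀ b, 9 * (ENNReal.ofReal (α * T' b) * ∫⁻ s, ENNReal.ofReal (g (T b) s ^ 4)) ≤
      3 * ((ENNReal.ofReal α + ENNReal.ofReal (T' b)) * ∫⁻ c, ENNReal.ofReal (v b c ^ 4)) +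
      18 * (∫⁻ c, ENNReal.ofReal (d2 b c ^ 2)) +
      2 * (ENNReal.ofReal (α * T' b) * ∫⁻ s, ENNReal.ofReal (s ^ 2 * g (T b) s ^ 6)) := fun b =>
    transport_ineq_line hα (hT'0 b)
      (hd2.comp (by fun_prop : Continuous fun c => (b, c)))
      (hg.comp (by fun_prop : Continuous fun c => (T b, c))) (h2 b) (hv0 b) (hg0 (T b))
      (fun c => (hvC b c).trans (hk b c)) (fun c => (hgC (T b) c).trans (hk (T b) c)) (hTH b)
  have t1 := lintegral_transport (T' := T') hTm hTs hTd (fun x => (hT'0 x).le)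
    (fun s => ∫⁻ t, ENNReal.ofReal (g s t ^ 4))
  have t2 := lintegral_transport (T' := T') hTm hTs hTd (fun x => (hT'0 x).le)
    (fun s => ∫⁻ t, ENNReal.ofReal (t ^ 2 * g s t ^ 6))
  have t3 := lintegral_transport (T' := T') hTm hTs hTd (fun x => (hT'0 x).le)
    (fun s => ∫⁻ t, ENNReal.ofReal (s ^ 2 * g s t ^ 6))
  have e3 : ENNReal.ofReal α * ∫⁻ s, ∫⁻ t, ENNReal.ofReal (s ^ 2 * g s t ^ 6) =
      ∫⁻ b, ENNReal.ofReal (T b ^ 2) * ∫⁻ c, ENNReal.ofReal (v b c ^ 6) := by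
    rw [← t3, ← lintegral_const_mul' _ _ ENNReal.ofReal_ne_top]
    refine lintegral_congr fun b => ?_
    rw [lintegral_eq_ofReal_integral (Hi' b) (fun c => (pow_pos (hv0 b c) 6).le)]
    simp_rw [ENNReal.ofReal_mul (sq_nonneg (T b))]
    rw [lintegral_const_mul' _ _ ENNReal.ofReal_ne_top,
      lintegral_eq_ofReal_integral (Gi' _) (fun c => (pow_pos (hg0 (T b) c) 6).le)]
    change _ * (_ * (_ * ENNReal.ofReal (G (T b)))) = ENNReal.ofReal (T b ^ 2) * ENNReal.ofReal (H b)
    rw [hTH b, ENNReal.ofReal_mul (mul_pos hα (hT'0 b)).le, ENNReal.ofReal_mul hα.le]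
    ring
  have mV : Measurable fun b => ∫⁻ c, ENNReal.ofReal (v b c ^ 4) :=
    Measurable.lintegral_prod_right' (f := fun p : ℝ × ℝ => ENNReal.ofReal (v p.1 p.2 ^ 4))
      (Continuous.measurable (by fun_prop)).ennreal_ofReal
  have mD : Measurable fun b => ∫⁻ c, ENNReal.ofReal (d2 b c ^ 2) :=
    Measurable.lintegral_prod_right' (f := fun p : ℝ × ℝ => ENNReal.ofReal (d2 p.1 p.2 ^ 2))
      (Continuous.measurable (by fun_prop)).ennreal_ofReal
  have mT : Measurable fun b => ENNReal.ofReal (T' b) := hT'c.measurable.ennreal_ofReal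
  have int := lintegral_mono (μ := volume) line
  rw [lintegral_add_left (by fun_prop), lintegral_add_left (by fun_prop),
    lintegral_const_mul' _ _ (by simp), lintegral_const_mul' _ _ (by simp),
    lintegral_const_mul' _ _ (by simp), lintegral_const_mul' _ _ (by simp)] at int
  simp_rw [add_mul, ENNReal.ofReal_mul hα.le, mul_assoc] at int
  rw [lintegral_add_left (by fun_prop), lintegral_const_mul' _ _ (by simp),
    lintegral_const_mul' _ _ (by simp), lintegral_const_mul' _ _ (by simp), t1, t2] at int
  refine int.trans ?_
  rw [mul_add (ENNReal.ofReal α), e3]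
  calc _ = 3 * (ENNReal.ofReal α * ∫⁻ b, ∫⁻ c, ENNReal.ofReal (v b c ^ 4)) +
        (3 * ∫⁻ b, ENNReal.ofReal (T' b) * ∫⁻ c, ENNReal.ofReal (v b c ^ 4)) +
        18 * (∫⁻ b, ∫⁻ c, ENNReal.ofReal (d2 b c ^ 2)) +
        2 * (ENNReal.ofReal α * ∫⁻ s, ∫⁻ t, ENNReal.ofReal (t ^ 2 * g s t ^ 6)) := by ring
    _ ≤ _ := by
      refine (add_le_add_left (add_le_add_left (add_le_add_right hslice _) _) _).trans
        (le_of_eq ?_)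
      ring

/-- Transport inequality in three variables. -/
lemma transport_ineq_space {v d1 d2 d3 g : ℝ → ℝ → ℝ → ℝ} {C : ℝ}
    (hv : Continuous fun p : ℝ × ℝ × ℝ => v p.1 p.2.1 p.2.2)
    (hd1 : Continuous fun p : ℝ × ℝ × ℝ => d1 p.1 p.2.1 p.2.2)
    (hd2 : Continuous fun p : ℝ × ℝ × ℝ => d2 p.1 p.2.1 p.2.2)
    (hd3 : Continuous fun p : ℝ × ℝ × ℝ => d3 p.1 p.2.1 p.2.2)
    (hg : Continuous fun p : ℝ × ℝ × ℝ => g p.1 p.2.1 p.2.2)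
    (h1 : ∀ a b c, HasDerivAt (fun s => v s b c) (d1 a b c) a)
    (h2 : ∀ a b c, HasDerivAt (fun s => v a s c) (d2 a b c) b)
    (h3 : ∀ a b c, HasDerivAt (fun s => v a b s) (d3 a b c) c)
    (hv0 : ∀ a b c, 0 < v a b c) (hg0 : ∀ a b c, 0 < g a b c)
    (hvC : ∀ a b c, v a b c ^ 6 ≤ C * (lineWeight a * (lineWeight b * lineWeight c)))
    (hgC : ∀ a b c, g a b c ^ 6 ≤ C * (lineWeight a * (lineWeight b * lineWeight c)))
    (hm : ∫⁻ a, ∫⁻ b, ∫⁻ c, ENNReal.ofReal (v a b c ^ 6) =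
      ∫⁻ a, ∫⁻ b, ∫⁻ c, ENNReal.ofReal (g a b c ^ 6)) :
    9 * (∫⁻ r, ∫⁻ s, ∫⁻ t, ENNReal.ofReal (g r s t ^ 4)) ≤
      18 * ((∫⁻ a, ∫⁻ b, ∫⁻ c, ENNReal.ofReal (d1 a b c ^ 2)) +
        ((∫⁻ a, ∫⁻ b, ∫⁻ c, ENNReal.ofReal (d2 a b c ^ 2)) +
        ∫⁻ a, ∫⁻ b, ∫⁻ c, ENNReal.ofReal (d3 a b c ^ 2))) +
      2 * ((∫⁻ r, ∫⁻ s, ∫⁻ t, ENNReal.ofReal (r ^ 2 * g r s t ^ 6)) +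
        ((∫⁻ r, ∫⁻ s, ∫⁻ t, ENNReal.ofReal (s ^ 2 * g r s t ^ 6)) +
        ∫⁻ r, ∫⁻ s, ∫⁻ t, ENNReal.ofReal (t ^ 2 * g r s t ^ 6))) := by
  have hC : 0 ≤ C := by
    have := (pow_pos (hv0 0 0 0) 6).trans_le (hvC 0 0 0)
    exact (pos_of_mul_pos_left this (mul_pos (lineWeight_pos 0)
      (mul_pos (lineWeight_pos 0) (lineWeight_pos 0))).le).le
  have w0 := fun x => (lineWeight_pos x).le
  have hbc : ∀ a b c, C * (lineWeight a * (lineWeight b * lineWeight c)) ≤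
      C * (lineWeight b * lineWeight c) := fun a b c =>
    mul_le_mul_of_nonneg_left (mul_le_of_le_one_left (mul_nonneg (w0 b) (w0 c))
      (lineWeight_le_one a)) hC
  have hc : ∀ a b c, C * (lineWeight a * (lineWeight b * lineWeight c)) ≤
      C * lineWeight c := fun a b c => (hbc a b c).trans <|
    mul_le_mul_of_nonneg_left (mul_le_of_le_one_left (w0 c) (lineWeight_le_one b)) hC
  have ha : ∀ a b c, C * (lineWeight a * (lineWeight b * lineWeight c)) ≤
      C * lineWeight a := fun a b c =>
    mul_le_mul_of_nonneg_left (mul_le_of_le_one_right (w0 a)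
      (mul_le_one₀ (lineWeight_le_one b) (w0 c) (lineWeight_le_one c))) hC
  have marg : ∀ {h : ℝ → ℝ → ℝ → ℝ}, (Continuous fun p : ℝ × ℝ × ℝ => h p.1 p.2.1 p.2.2) →
      (∀ a b c, 0 < h a b c) →
      (∀ a b c, h a b c ^ 6 ≤ C * (lineWeight a * (lineWeight b * lineWeight c))) →
      Continuous (fun a => ∫ b, ∫ c, h a b c ^ 6) ∧ (∀ a, 0 < ∫ b, ∫ c, h a b c ^ 6) ∧
      (∀ a, ∫⁻ b, ∫⁻ c, ENNReal.ofReal (h a b c ^ 6) =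
        ENNReal.ofReal (∫ b, ∫ c, h a b c ^ 6)) ∧
      Integrable (fun a => ∫ b, ∫ c, h a b c ^ 6) := by
    intro h hh hh0 hhC
    obtain ⟨m1, m2, m3⟩ := marginal_props (X := ℝ × ℝ) (F := fun p c => h p.1 p.2 c ^ 6) (C := C)
      (by
        simp only [Function.uncurry_def]
        exact (hh.comp (by fun_prop : Continuous fun q : (ℝ × ℝ) × ℝ =>
          (q.1.1, q.1.2, q.2))).pow 6) (fun p c => pow_pos (hh0 _ _ c) 6)
      (fun p c => (hhC _ _ c).trans (hc _ _ c))
    have b1 : ∀ a b, ∫ c, h a b c ^ 6 ≤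
        C * (∫ c, lineWeight c) * (lineWeight a * lineWeight b) := fun a b =>
      calc ∫ c, h a b c ^ 6 ≤ ∫ c, C * (lineWeight a * (lineWeight b * lineWeight c)) :=
          integral_mono (m3 (a, b)) (((integrable_lineWeight.const_mul _).const_mul _).const_mul _)
            (hhC a b)
        _ = _ := by rw [integral_const_mul, integral_const_mul, integral_const_mul]; ring
    have hW : 0 ≤ ∫ c, lineWeight c := integral_nonneg fun c => w0 c
    obtain ⟨n1, n2, n3⟩ := marginal_props (X := ℝ) (F := fun a b => ∫ c, h a b c ^ 6)
      (C := C * (∫ c, lineWeight c)) m1 (fun a b => m2 (a, b))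
      (fun a b => (b1 a b).trans (mul_le_mul_of_nonneg_left
        (mul_le_of_le_one_left (w0 b) (lineWeight_le_one a)) (mul_nonneg hC hW)))
    refine ⟨n1, n2, fun a => ?_, ?_⟩
    · rw [← lintegral_eq_ofReal_integral (n3 a) (fun b => (m2 (a, b)).le)]
      refine lintegral_congr fun b => ?_
      exact lintegral_eq_ofReal_integral (m3 (a, b)) (fun c => (pow_pos (hh0 a b c) 6).le)
    · refine (integrable_lineWeight.const_mul
        (C * (∫ c, lineWeight c) * ∫ c, lineWeight c)).mono'
        n1.aestronglyMeasurable (Eventually.of_forall fun a => ?_)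
      rw [Real.norm_of_nonneg (n2 a).le]
      calc ∫ b, ∫ c, h a b c ^ 6 ≤
            ∫ b, C * (∫ c, lineWeight c) * (lineWeight a * lineWeight b) :=
          integral_mono (n3 a) ((integrable_lineWeight.const_mul _).const_mul _) (b1 a)
        _ = _ := by rw [integral_const_mul, integral_const_mul]; ring
  obtain ⟨Hc, H0, Hi', Hi⟩ := marg hv hv0 hvC
  obtain ⟨Gc, G0, Gi', Gi⟩ := marg hg hg0 hgC
  set H : ℝ → ℝ := fun a => ∫ b, ∫ c, v a b c ^ 6 with hH
  set G : ℝ → ℝ := fun a => ∫ b, ∫ c, g a b c ^ 6 with hG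
  have hmass : ∫ x, H x = ∫ x, G x := by
    simp_rw [Hi', Gi'] at hm
    rw [lintegral_eq_ofReal_integral Hi fun a => (H0 a).le,
      lintegral_eq_ofReal_integral Gi fun a => (G0 a).le] at hm
    exact (ENNReal.ofReal_eq_ofReal_iff (integral_nonneg fun a => (H0 a).le)
      (integral_nonneg fun a => (G0 a).le)).1 hm
  obtain ⟨T, hTm, hTs, hTd⟩ := exists_monotone_transport Hc Gc H0 G0 Hi Gi hmass
  set T' : ℝ → ℝ := fun x => H x / G (T x) with hT'
  have hTc : Continuous T := continuous_iff_continuousAt.2 fun x => (hTd x).continuousAt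
  have hT'c : Continuous T' := Continuous.div (by fun_prop) (by fun_prop) fun x => (G0 _).ne'
  have hT'0 : ∀ x, 0 < T' x := fun x => div_pos (H0 x) (G0 _)
  have hTH : ∀ x, H x = T' x * G (T x) := fun x => by
    have : G (T x) ≠ 0 := (G0 (T x)).ne'
    rw [hT']
    field_simp
  have hslice := lintegral_transport_slice (Z := ℝ × ℝ) volume (v := fun a z => v a z.1 z.2)
    (dv := fun a z => d1 a z.1 z.2) (T := T) (T' := T') hv hd1 (fun a z => h1 a z.1 z.2)
    (fun a z => (hv0 a z.1 z.2).le)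
    (fun z => tendsto_zero_of_pow_le_lineWeight (fun a => (hv0 a _ _).le) tendsto_lineWeight_atBot
      fun a => (hvC a _ _).trans (ha a _ _))
    (fun z => tendsto_zero_of_pow_le_lineWeight (fun a => (hv0 a _ _).le) tendsto_lineWeight_atTop
      fun a => (hvC a _ _).trans (ha a _ _))
    hTd hT'c (fun x => (hT'0 x).le)
  have fub : ∀ {f : ℝ → ℝ → ℝ → ℝ} (_ : Continuous fun p : ℝ × ℝ × ℝ => f p.1 p.2.1 p.2.2) (a : ℝ),
      ∫⁻ z : ℝ × ℝ, ENNReal.ofReal (f a z.1 z.2) = ∫⁻ b, ∫⁻ c, ENNReal.ofReal (f a b c) := by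
    intro f hf a
    exact lintegral_prod (μ := (volume : Measure ℝ)) (ν := (volume : Measure ℝ))
      (fun z : ℝ × ℝ => ENNReal.ofReal (f a z.1 z.2))
      (hf.comp (by fun_prop : Continuous fun z : ℝ × ℝ => (a, z))).measurable.ennreal_ofReal.aemeasurable
  have meas : ∀ {f : ℝ → ℝ → ℝ → ℝ} (_ : Continuous fun p : ℝ × ℝ × ℝ => f p.1 p.2.1 p.2.2),
      Measurable fun a => ∫⁻ b, ∫⁻ c, ENNReal.ofReal (f a b c) := by
    intro f hf
    simp_rw [← fub hf]
    exact Measurable.lintegral_prod_right'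
      (f := fun p : ℝ × ℝ × ℝ => ENNReal.ofReal (f p.1 p.2.1 p.2.2)) hf.measurable.ennreal_ofReal
  simp_rw [fub (f := fun a b c => v a b c ^ 4) (hv.pow 4),
    fub (f := fun a b c => v a b c ^ 6) (hv.pow 6),
    fub (f := fun a b c => d1 a b c ^ 2) (hd1.pow 2)] at hslice
  have plane : ∀ a, 9 * (ENNReal.ofReal (T' a) *
        ∫⁻ s, ∫⁻ t, ENNReal.ofReal (g (T a) s t ^ 4)) ≤
      3 * (ENNReal.ofReal (T' a) * ∫⁻ b, ∫⁻ c, ENNReal.ofReal (v a b c ^ 4)) +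
      18 * ((∫⁻ b, ∫⁻ c, ENNReal.ofReal (d2 a b c ^ 2)) +
        ∫⁻ b, ∫⁻ c, ENNReal.ofReal (d3 a b c ^ 2)) +
      2 * (ENNReal.ofReal (T' a) *
        ((∫⁻ s, ∫⁻ t, ENNReal.ofReal (s ^ 2 * g (T a) s t ^ 6)) +
        ∫⁻ s, ∫⁻ t, ENNReal.ofReal (t ^ 2 * g (T a) s t ^ 6))) := fun a =>
    transport_ineq_plane (hT'0 a)
      (hv.comp (by fun_prop : Continuous fun z : ℝ × ℝ => (a, z)))
      (hd2.comp (by fun_prop : Continuous fun z : ℝ × ℝ => (a, z)))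
      (hd3.comp (by fun_prop : Continuous fun z : ℝ × ℝ => (a, z)))
      (hg.comp (by fun_prop : Continuous fun z : ℝ × ℝ => (T a, z))) (h2 a) (h3 a)
      (hv0 a) (hg0 (T a))
      (fun b c => (hvC a b c).trans (hbc a b c)) (fun b c => (hgC _ b c).trans (hbc _ b c)) (hTH a)
  have t1 := lintegral_transport (T' := T') hTm hTs hTd (fun x => (hT'0 x).le)
    (fun r => ∫⁻ s, ∫⁻ t, ENNReal.ofReal (g r s t ^ 4))
  have t2 := lintegral_transport (T' := T') hTm hTs hTd (fun x => (hT'0 x).le)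
    (fun r => ((∫⁻ s, ∫⁻ t, ENNReal.ofReal (s ^ 2 * g r s t ^ 6)) +
        ∫⁻ s, ∫⁻ t, ENNReal.ofReal (t ^ 2 * g r s t ^ 6)))
  have t3 := lintegral_transport (T' := T') hTm hTs hTd (fun x => (hT'0 x).le)
    (fun r => ∫⁻ s, ∫⁻ t, ENNReal.ofReal (r ^ 2 * g r s t ^ 6))
  have e3 : ∫⁻ r, ∫⁻ s, ∫⁻ t, ENNReal.ofReal (r ^ 2 * g r s t ^ 6) =
      ∫⁻ a, ENNReal.ofReal (T a ^ 2) * ∫⁻ b, ∫⁻ c, ENNReal.ofReal (v a b c ^ 6) := by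
    rw [← t3]
    refine lintegral_congr fun a => ?_
    simp_rw [ENNReal.ofReal_mul (sq_nonneg (T a)),
      lintegral_const_mul' _ _ (ENNReal.ofReal_ne_top (r := T a ^ 2))]
    rw [Hi', Gi']
    change _ * (_ * ENNReal.ofReal (G (T a))) = ENNReal.ofReal (T a ^ 2) * ENNReal.ofReal (H a)
    rw [hTH a, ENNReal.ofReal_mul (hT'0 a).le]
    ring
  have mV := meas (f := fun a b c => v a b c ^ 4) (hv.pow 4)
  have mD2 := meas (f := fun a b c => d2 a b c ^ 2) (hd2.pow 2)
  have mD3 := meas (f := fun a b c => d3 a b c ^ 2) (hd3.pow 2)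
  have mT : Measurable fun b => ENNReal.ofReal (T' b) := hT'c.measurable.ennreal_ofReal
  have mS := meas (f := fun r s t => s ^ 2 * g r s t ^ 6) (by fun_prop)
  have int := lintegral_mono (μ := volume) plane
  rw [lintegral_add_left (by fun_prop), lintegral_add_left (by fun_prop),
    lintegral_const_mul' _ _ (by simp), lintegral_const_mul' _ _ (by simp),
    lintegral_const_mul' _ _ (by simp), lintegral_const_mul' _ _ (by simp), t1, t2,
    lintegral_add_left mD2, lintegral_add_left mS] at int
  refine int.trans ?_
  rw [e3]
  calc _ ≤ _ := add_le_add_left (add_le_add_left hslice _) _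
    _ = _ := by ring

lemma continuous_vec3 : Continuous fun p : ℝ × ℝ × ℝ => (!₂[p.1, p.2.1, p.2.2] : E3) := by
  refine (PiLp.continuous_toLp 2 _).comp (continuous_pi fun i => ?_)
  fin_cases i <;> simp <;> fun_prop

lemma norm_sq_vec3 (a b c : ℝ) : ‖(!₂[a, b, c] : E3)‖ ^ 2 = a ^ 2 + b ^ 2 + c ^ 2 := by
  rw [EuclideanSpace.real_norm_sq_eq]
  simp [Fin.sum_univ_three]

lemma lintegral_insertNth (i : Fin 3) {F : E3 → ℝ≥0∞} (hF : Measurable F) :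
    ∫⁻ x, F x = ∫⁻ s : ℝ, ∫⁻ z : Fin 2 → ℝ, F (WithLp.toLp 2 (i.insertNth s z)) := by
  have h1 := (EuclideanSpace.volume_preserving_symm_measurableEquiv_toLp (Fin 3)).symm
  rw [← h1.lintegral_comp hF]
  have h2 := (volume_preserving_piFinSuccAbove (fun _ : Fin 3 => ℝ) i).symm
  refine (h2.lintegral_comp (hF.comp h1.measurable)).symm.trans ?_
  rw [Measure.volume_eq_prod]
  refine (lintegral_prod _ ((hF.comp h1.measurable).comp h2.measurable).aemeasurable).trans ?_
  rfl

lemma lintegral_vec3 {F : E3 → ℝ≥0∞} (hF : Measurable F) :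
    ∫⁻ x, F x = ∫⁻ a, ∫⁻ b, ∫⁻ c, F !₂[a, b, c] := by
  rw [lintegral_insertNth 0 hF]
  refine lintegral_congr fun a => ?_
  have h2 := (volume_preserving_finTwoArrow ℝ).symm
  have hm : Measurable fun z : Fin 2 → ℝ => F (WithLp.toLp 2 (Fin.insertNth (0 : Fin 3) a z)) := by
    refine hF.comp ?_
    refine (WithLp.measurable_toLp 2 (Fin 3 → ℝ)).comp ?_
    exact ((MeasurableEquiv.piFinSuccAbove (fun _ : Fin 3 => ℝ) 0).symm.measurable).comp
      (measurable_const.prodMk measurable_id)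
  rw [← h2.lintegral_comp hm, Measure.volume_eq_prod]
  refine (lintegral_prod _ (hm.comp h2.measurable).aemeasurable).trans ?_
  refine lintegral_congr fun b => lintegral_congr fun c => ?_
  refine congrArg F ?_
  ext j
  fin_cases j <;> rfl

lemma W_pos (x : E3) : 0 < W x := by unfold W; positivity

lemma W_sq (x : E3) : W x ^ 2 = (1 + ‖x‖ ^ 2 / 3)⁻¹ := by
  have h : 0 ≤ 1 + ‖x‖ ^ 2 / 3 := by positivity
  unfold W
  generalize 1 + ‖x‖ ^ 2 / 3 = q at h
  rw [← Real.rpow_natCast, ← Real.rpow_mul h, ← Real.rpow_neg_one]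
  norm_num

lemma W_pow_four (x : E3) : W x ^ 4 = ((1 + ‖x‖ ^ 2 / 3)⁻¹) ^ 2 := by rw [← W_sq]; ring

lemma W_pow_six (x : E3) : W x ^ 6 = ((1 + ‖x‖ ^ 2 / 3)⁻¹) ^ 3 := by rw [← W_sq]; ring

lemma hasFDerivAt_W (x : E3) :
    HasFDerivAt W ((-(1 / 3) * W x ^ 3) • innerSL ℝ x) x := by
  have h1 : HasFDerivAt (fun y : E3 => 1 + ‖y‖ ^ 2 / 3) ((2 / 3 : ℝ) • innerSL ℝ x) x := by
    have := ((hasStrictFDerivAt_norm_sq x).hasFDerivAt.const_mul (1 / 3 : ℝ)).const_add 1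
    refine (this.congr_of_eventuallyEq (Eventually.of_forall fun y => ?_)).congr_fderiv ?_
    · simp only []; ring
    · ext y; simp; ring
  have h0 : 0 < 1 + ‖x‖ ^ 2 / 3 := by positivity
  have h2 := h1.rpow_const (p := -(1 : ℝ) / 2) (Or.inl h0.ne')
  refine h2.congr_fderiv ?_
  have h3 : (1 + ‖x‖ ^ 2 / 3) ^ (-(1 : ℝ) / 2 - 1) = W x ^ 3 := by
    unfold W
    generalize 1 + ‖x‖ ^ 2 / 3 = q at h0
    rw [← Real.rpow_natCast, ← Real.rpow_mul h0.le]
    norm_num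
  rw [h3, smul_smul]
  congr 1
  ring

lemma contDiff_W : ContDiff ℝ (⊤ : ℕ∞) W := by
  unfold W
  refine ContDiff.rpow_const_of_ne ?_ fun x => by positivity
  exact contDiff_const.add ((contDiff_norm_sq ℝ).div_const _)

lemma pdR_W (i : Fin 3) (x : E3) : pdR i W x = -(1 / 3) * W x ^ 3 * x i := by
  unfold pdR e3
  rw [(hasFDerivAt_W x).fderiv]
  simp [innerSL_apply_apply, EuclideanSpace.inner_single_right]

lemma gradSqR_W (x : E3) : gradSqR W x = (1 / 9) * (‖x‖ ^ 2 * W x ^ 6) := by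
  unfold gradSqR
  simp_rw [pdR_W]
  rw [EuclideanSpace.real_norm_sq_eq, Fin.sum_univ_three, Fin.sum_univ_three]
  ring

lemma integrable_W_pow_four : Integrable fun x => W x ^ 4 := by
  have h := integrable_rpow_neg_one_add_norm_sq (E := E3) (μ := volume) (r := 4) (by simp; norm_num)
  refine (h.const_mul 9).mono' (contDiff_W.continuous.pow 4).aestronglyMeasurable
    (Eventually.of_forall fun x => ?_)
  rw [Real.norm_of_nonneg (pow_pos (W_pos x) 4).le, W_pow_four]
  have e : (1 + ‖x‖ ^ 2) ^ (-(4 : ℝ) / 2) = ((1 + ‖x‖ ^ 2)⁻¹) ^ 2 := by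
    have h0 : 0 ≤ 1 + ‖x‖ ^ 2 := by positivity
    generalize 1 + ‖x‖ ^ 2 = q at h0
    rw [← Real.rpow_neg_one, ← Real.rpow_natCast, ← Real.rpow_mul h0]
    norm_num
  rw [e, show (9 : ℝ) = 3 ^ 2 by norm_num, ← mul_pow]
  refine pow_le_pow_left₀ (by positivity) ?_ 2
  rw [← div_eq_mul_inv, inv_eq_one_div, div_le_div_iff₀ (by positivity) (by positivity)]
  nlinarith [sq_nonneg ‖x‖]

lemma W_le_one (x : E3) : W x ≤ 1 := by
  have h : W x ^ 2 ≤ 1 := by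
    rw [W_sq]; exact inv_le_one_of_one_le₀ (by nlinarith [sq_nonneg ‖x‖])
  nlinarith [W_pos x]

lemma norm_sq_mul_W_sq_le (x : E3) : ‖x‖ ^ 2 * W x ^ 2 ≤ 3 := by
  rw [W_sq, ← div_eq_mul_inv, div_le_iff₀ (by positivity)]
  linarith

lemma integrable_W_pow_six : Integrable fun x => W x ^ 6 := by
  refine integrable_W_pow_four.mono' (contDiff_W.continuous.pow 6).aestronglyMeasurable
    (Eventually.of_forall fun x => ?_)
  rw [Real.norm_of_nonneg (pow_pos (W_pos x) 6).le]
  exact pow_le_pow_of_le_one (W_pos x).le (W_le_one x) (by norm_num)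

lemma integrable_gradSqR_W : Integrable (gradSqR W) := by
  have e : gradSqR W = fun x => (1 / 9) * (‖x‖ ^ 2 * W x ^ 6) := funext gradSqR_W
  have hc := contDiff_W.continuous
  rw [e]
  refine integrable_W_pow_four.mono' (Continuous.aestronglyMeasurable (by fun_prop))
    (Eventually.of_forall fun x => ?_)
  have := W_pos x
  rw [Real.norm_of_nonneg (by positivity)]
  nlinarith [mul_le_mul_of_nonneg_right (norm_sq_mul_W_sq_le x) (pow_pos this 4).le,
    pow_pos this 4]

lemma lintegral_line_identity {A : ℝ} (hA : 1 ≤ A) :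
    3 * ∫⁻ s : ℝ, ENNReal.ofReal (((A + s ^ 2 / 3)⁻¹) ^ 2) =
      4 * ∫⁻ s : ℝ, ENNReal.ofReal (s ^ 2 * ((A + s ^ 2 / 3)⁻¹) ^ 3) := by
  have hp : ∀ s : ℝ, 0 < A + s ^ 2 / 3 := fun s => by positivity
  have hk0 : ∀ s : ℝ, 0 < (A + s ^ 2 / 3)⁻¹ := fun s => inv_pos.2 (hp s)
  have hk : ∀ s : ℝ, (A + s ^ 2 / 3)⁻¹ ≤ lineWeight s := fun s => by
    unfold lineWeight
    exact inv_anti₀ (by positivity) (by linarith)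
  have hc : Continuous fun s : ℝ => (A + s ^ 2 / 3)⁻¹ :=
    Continuous.inv₀ (by fun_prop) fun s => (hp s).ne'
  have b1 : ∀ s : ℝ, ((A + s ^ 2 / 3)⁻¹) ^ 2 ≤ lineWeight s := fun s => by
    nlinarith [hk s, hk0 s, lineWeight_le_one s]
  have b2 : ∀ s : ℝ, s ^ 2 * ((A + s ^ 2 / 3)⁻¹) ^ 3 ≤ 3 * lineWeight s := fun s => by
    have e : s ^ 2 * (A + s ^ 2 / 3)⁻¹ ≤ 3 := by
      rw [← div_eq_mul_inv, div_le_iff₀ (hp s)]; linarith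
    nlinarith [b1 s, mul_le_mul_of_nonneg_right e (sq_nonneg (A + s ^ 2 / 3)⁻¹)]
  have i1 : Integrable fun s : ℝ => ((A + s ^ 2 / 3)⁻¹) ^ 2 :=
    integrable_lineWeight.mono' (hc.pow 2).aestronglyMeasurable
      (Eventually.of_forall fun s => by rw [Real.norm_of_nonneg (by positivity)]; exact b1 s)
  have i2 : Integrable fun s : ℝ => s ^ 2 * ((A + s ^ 2 / 3)⁻¹) ^ 3 :=
    (integrable_lineWeight.const_mul 3).mono'
      (Continuous.aestronglyMeasurable (by fun_prop))
      (Eventually.of_forall fun s => by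
        have := hk0 s
        rw [Real.norm_of_nonneg (by positivity)]; exact b2 s)
  have hd : ∀ s : ℝ, HasDerivAt (fun s : ℝ => s * ((A + s ^ 2 / 3)⁻¹) ^ 2)
      (((A + s ^ 2 / 3)⁻¹) ^ 2 - 4 / 3 * (s ^ 2 * ((A + s ^ 2 / 3)⁻¹) ^ 3)) s := by
    intro s
    have h1 : HasDerivAt (fun s : ℝ => A + s ^ 2 / 3) (2 * s / 3) s := by
      simpa using ((hasDerivAt_pow 2 s).div_const 3).const_add A
    have h2 := (hasDerivAt_id' s).fun_mul ((h1.fun_inv (hp s).ne').fun_pow 2)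
    refine h2.congr_deriv ?_
    have := (hp s).ne'
    generalize A + s ^ 2 / 3 = q at this
    norm_num
    field_simp
    ring
  have hlim : ∀ {l : Filter ℝ}, Tendsto lineWeight l (𝓝 0) →
      Tendsto (fun s : ℝ => s * ((A + s ^ 2 / 3)⁻¹) ^ 2) l (𝓝 0) := by
    intro l hl
    refine squeeze_zero_norm (fun s => ?_) hl
    rw [norm_mul, Real.norm_of_nonneg (pow_pos (hk0 s) 2).le, Real.norm_eq_abs]
    have e : |s| * (A + s ^ 2 / 3)⁻¹ ≤ 1 := by
      rw [← div_eq_mul_inv, div_le_one (hp s), ← sq_abs]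
      nlinarith [sq_nonneg (|s| - 3 / 2)]
    nlinarith [hk s, hk0 s, mul_le_mul_of_nonneg_right e (hk0 s).le]
  have key := integral_of_hasDerivAt_of_tendsto hd (i1.sub (i2.const_mul _))
    (hlim tendsto_lineWeight_atBot) (hlim tendsto_lineWeight_atTop)
  rw [integral_sub i1 (i2.const_mul _), integral_const_mul] at key
  rw [lintegral_eq_ofReal_integral i1 fun s => by positivity,
    lintegral_eq_ofReal_integral i2 fun s => by have := hk0 s; positivity]
  have k3 : (3 : ℝ≥0∞) = ENNReal.ofReal 3 := by simp
  have k4 : (4 : ℝ≥0∞) = ENNReal.ofReal 4 := by simp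
  rw [k3, k4, ← ENNReal.ofReal_mul (by norm_num), ← ENNReal.ofReal_mul (by norm_num)]
  congr 1
  linarith

lemma lintegral_W_coord (i : Fin 3) :
    3 * ∫⁻ x, ENNReal.ofReal (W x ^ 4) = 4 * ∫⁻ x, ENNReal.ofReal (x i ^ 2 * W x ^ 6) := by
  have hc := contDiff_W.continuous
  have m1 : Measurable fun x => ENNReal.ofReal (W x ^ 4) :=
    (Continuous.measurable (by fun_prop)).ennreal_ofReal
  have m2 : Measurable fun x : E3 => ENNReal.ofReal (x i ^ 2 * W x ^ 6) :=
    (Continuous.measurable (by fun_prop)).ennreal_ofReal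
  have hins : Measurable fun p : ℝ × (Fin 2 → ℝ) =>
      (WithLp.toLp 2 (i.insertNth p.1 p.2 : Fin 3 → ℝ) : E3) :=
    (WithLp.measurable_toLp 2 (Fin 3 → ℝ)).comp
      (MeasurableEquiv.piFinSuccAbove (fun _ : Fin 3 => ℝ) i).symm.measurable
  rw [lintegral_insertNth i m1, lintegral_insertNth i m2,
    lintegral_lintegral_swap
      (f := fun s z => ENNReal.ofReal (W (WithLp.toLp 2 (i.insertNth s z)) ^ 4))
      (m1.comp hins).aemeasurable,
    lintegral_lintegral_swap
      (f := fun s z => ENNReal.ofReal ((WithLp.toLp 2 (i.insertNth s z) : E3) i ^ 2 *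
        W (WithLp.toLp 2 (i.insertNth s z)) ^ 6))
      (m2.comp hins).aemeasurable,
    ← lintegral_const_mul' _ _ (by simp), ← lintegral_const_mul' _ _ (by simp)]
  refine lintegral_congr fun z => ?_
  have hn : ∀ s : ℝ, 1 + ‖(WithLp.toLp 2 (i.insertNth s z : Fin 3 → ℝ) : E3)‖ ^ 2 / 3 =
      (1 + (z 0 ^ 2 + z 1 ^ 2) / 3) + s ^ 2 / 3 := fun s => by
    rw [EuclideanSpace.real_norm_sq_eq, Fin.sum_univ_succAbove _ i]
    simp
    ring
  simp_rw [W_pow_four, W_pow_six, hn]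
  simp only [Fin.insertNth_apply_same]
  exact lintegral_line_identity (by nlinarith [sq_nonneg (z 0), sq_nonneg (z 1)])

lemma lintegral_W_pow_four :
    ∫⁻ x, ENNReal.ofReal (W x ^ 4) = 4 * ∫⁻ x, ENNReal.ofReal (gradSqR W x) := by
  have hc := contDiff_W.continuous
  have e : ∀ x, ENNReal.ofReal (gradSqR W x) = ENNReal.ofReal (1 / 9) *
      (ENNReal.ofReal (x 0 ^ 2 * W x ^ 6) + ENNReal.ofReal (x 1 ^ 2 * W x ^ 6) +
      ENNReal.ofReal (x 2 ^ 2 * W x ^ 6)) := fun x => by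
    have := W_pos x
    rw [← ENNReal.ofReal_add (by positivity) (by positivity),
      ← ENNReal.ofReal_add (by positivity) (by positivity), ← ENNReal.ofReal_mul (by norm_num),
      gradSqR_W, EuclideanSpace.real_norm_sq_eq, Fin.sum_univ_three]
    congr 1
    ring
  have m : ∀ i : Fin 3, Measurable fun x : E3 => ENNReal.ofReal (x i ^ 2 * W x ^ 6) := fun i =>
    (Continuous.measurable (by fun_prop)).ennreal_ofReal
  simp_rw [e]
  rw [lintegral_const_mul' _ _ (by simp), lintegral_add_right _ (m 2), lintegral_add_right _ (m 1)]
  have h9 : (9 : ℝ≥0∞) * ENNReal.ofReal (1 / 9) = 1 := by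
    rw [show (9 : ℝ≥0∞) = ENNReal.ofReal 9 by simp, ← ENNReal.ofReal_mul (by norm_num)]
    norm_num
  have h := congrArg₂ (· + ·) (congrArg₂ (· + ·) (lintegral_W_coord 0) (lintegral_W_coord 1))
    (lintegral_W_coord 2)
  simp only [] at h
  have h' : 9 * ∫⁻ x, ENNReal.ofReal (W x ^ 4) = 4 * ((∫⁻ x : E3, ENNReal.ofReal (x 0 ^ 2 * W x ^ 6)) +
      (∫⁻ x : E3, ENNReal.ofReal (x 1 ^ 2 * W x ^ 6)) +
      ∫⁻ x : E3, ENNReal.ofReal (x 2 ^ 2 * W x ^ 6)) := by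
    rw [mul_add, mul_add, ← h]; ring
  calc ∫⁻ x, ENNReal.ofReal (W x ^ 4)
      = (9 * ENNReal.ofReal (1 / 9)) * ∫⁻ x, ENNReal.ofReal (W x ^ 4) := by rw [h9, one_mul]
    _ = ENNReal.ofReal (1 / 9) * (9 * ∫⁻ x, ENNReal.ofReal (W x ^ 4)) := by ring
    _ = _ := by rw [h']; ring

lemma hasDerivAt_comp_line {v : E3 → ℝ} {γ : ℝ → E3} {i : Fin 3} {s : ℝ}
    (hv : DifferentiableAt ℝ v (γ s)) (hγ : ∀ t, γ t = γ s + (t - s) • e3 i) :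
    HasDerivAt (fun t => v (γ t)) (pdR i v (γ s)) s := by
  have h : HasDerivAt γ (e3 i) s := by
    have h1 : HasDerivAt (fun t : ℝ => γ s + (t - s) • e3 i) ((1 : ℝ) • e3 i) s :=
      (((hasDerivAt_id s).sub_const s).smul_const (e3 i)).const_add _
    rw [one_smul] at h1
    exact h1.congr_of_eventuallyEq (Eventually.of_forall hγ)
  exact hv.hasFDerivAt.comp_hasDerivAt s h

lemma continuous_pdR {v : E3 → ℝ} (hv : ContDiff ℝ 1 v) (i : Fin 3) : Continuous (pdR i v) :=
  (hv.continuous_fderiv (by norm_num)).clm_apply continuous_const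

/-- Sharp Sobolev inequality: among positive functions dominated by `W` with the same `L⁶` mass
as `W`, the Dirichlet energy is minimised by `W`. -/
theorem sobolev_of_eq_mass {v : E3 → ℝ} {C : ℝ} (hv : ContDiff ℝ 1 v) (hv0 : ∀ x, 0 < v x)
    (hvC : ∀ x, v x ^ 6 ≤ C * W x ^ 6)
    (hm : ∫⁻ x, ENNReal.ofReal (v x ^ 6) = ∫⁻ x, ENNReal.ofReal (W x ^ 6)) :
    ∫⁻ x, ENNReal.ofReal (gradSqR W x) ≤ ∫⁻ x, ENNReal.ofReal (gradSqR v x) := by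
  have hWc := contDiff_W.continuous
  have hvc := hv.continuous
  have hp := fun i => continuous_pdR hv i
  have hWd : ∀ a b c, W !₂[a, b, c] ^ 6 ≤ lineWeight a * (lineWeight b * lineWeight c) := by
    intro a b c
    have hw : ∀ s t : ℝ, 0 ≤ t → (1 + (s ^ 2 + t) / 3)⁻¹ ≤ lineWeight s := fun s t ht => by
      unfold lineWeight
      exact inv_anti₀ (by positivity) (by linarith)
    rw [W_pow_six, norm_sq_vec3, pow_three]
    have p := fun s => (lineWeight_pos s).le
    have ha := hw a (b ^ 2 + c ^ 2) (by positivity)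
    have hb := hw b (a ^ 2 + c ^ 2) (by positivity)
    have hc := hw c (a ^ 2 + b ^ 2) (by positivity)
    rw [show a ^ 2 + (b ^ 2 + c ^ 2) = a ^ 2 + b ^ 2 + c ^ 2 by ring] at ha
    rw [show b ^ 2 + (a ^ 2 + c ^ 2) = a ^ 2 + b ^ 2 + c ^ 2 by ring] at hb
    rw [show c ^ 2 + (a ^ 2 + b ^ 2) = a ^ 2 + b ^ 2 + c ^ 2 by ring] at hc
    have q : 0 ≤ (1 + (a ^ 2 + b ^ 2 + c ^ 2) / 3)⁻¹ := by positivity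
    exact mul_le_mul ha (mul_le_mul hb hc q (p b)) (mul_nonneg q q) (p a)
  have hC1 : (1 : ℝ) ≤ max C 1 := le_max_right _ _
  have cW : Continuous fun p : ℝ × ℝ × ℝ => W !₂[p.1, p.2.1, p.2.2] := hWc.comp continuous_vec3
  have key := transport_ineq_space (v := fun a b c => v !₂[a, b, c])
    (d1 := fun a b c => pdR 0 v !₂[a, b, c]) (d2 := fun a b c => pdR 1 v !₂[a, b, c])
    (d3 := fun a b c => pdR 2 v !₂[a, b, c]) (g := fun a b c => W !₂[a, b, c]) (C := max C 1)
    (hvc.comp continuous_vec3) ((hp 0).comp continuous_vec3) ((hp 1).comp continuous_vec3)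
    ((hp 2).comp continuous_vec3) cW
    (fun a b c => hasDerivAt_comp_line (γ := fun s => !₂[s, b, c])
      (hv.differentiable (by norm_num) _) fun t => by
        ext j; fin_cases j <;> simp [e3])
    (fun a b c => hasDerivAt_comp_line (γ := fun s => !₂[a, s, c])
      (hv.differentiable (by norm_num) _) fun t => by
        ext j; fin_cases j <;> simp [e3])
    (fun a b c => hasDerivAt_comp_line (γ := fun s => !₂[a, b, s])
      (hv.differentiable (by norm_num) _) fun t => by
        ext j; fin_cases j <;> simp [e3])
    (fun a b c => hv0 _) (fun a b c => W_pos _)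
    (fun a b c => by
      refine (hvC _).trans ?_
      refine (mul_le_mul_of_nonneg_right (le_max_left C 1) (pow_pos (W_pos _) 6).le).trans ?_
      exact mul_le_mul_of_nonneg_left (hWd a b c) (by linarith))
    (fun a b c => by
      have h := hWd a b c
      have h0 : 0 ≤ lineWeight a * (lineWeight b * lineWeight c) :=
        (pow_pos (W_pos _) 6).le.trans h
      nlinarith)
    (by
      rw [← lintegral_vec3 (F := fun x => ENNReal.ofReal (v x ^ 6))
        (Continuous.measurable (by fun_prop)).ennreal_ofReal,
        ← lintegral_vec3 (F := fun x => ENNReal.ofReal (W x ^ 6))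
        (Continuous.measurable (by fun_prop)).ennreal_ofReal]
      exact hm)
  have mD : ∀ i, Measurable fun x => ENNReal.ofReal (pdR i v x ^ 2) := fun i =>
    ((hp i).pow 2).measurable.ennreal_ofReal
  have mX : ∀ i : Fin 3, Measurable fun x : E3 => ENNReal.ofReal (x i ^ 2 * W x ^ 6) := fun i =>
    (Continuous.measurable (by fun_prop)).ennreal_ofReal
  have x0 := lintegral_vec3 (mX 0)
  have x1 := lintegral_vec3 (mX 1)
  have x2 := lintegral_vec3 (mX 2)
  simp at x0 x1 x2
  rw [← lintegral_vec3 (mD 0), ← lintegral_vec3 (mD 1), ← lintegral_vec3 (mD 2),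
    ← lintegral_vec3 (F := fun x => ENNReal.ofReal (W x ^ 4))
        (Continuous.measurable (by fun_prop)).ennreal_ofReal, ← x0, ← x1, ← x2,
    ← lintegral_add_left (mD 1), ← lintegral_add_left (mD 0), lintegral_W_pow_four] at key
  have eg : ∀ x, ENNReal.ofReal (pdR 0 v x ^ 2) + (ENNReal.ofReal (pdR 1 v x ^ 2) +
      ENNReal.ofReal (pdR 2 v x ^ 2)) = ENNReal.ofReal (gradSqR v x) := fun x => by
    rw [← ENNReal.ofReal_add (by positivity) (by positivity),
      ← ENNReal.ofReal_add (by positivity) (by positivity), gradSqR, Fin.sum_univ_three, add_assoc]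
  simp_rw [eg] at key
  have hs : ∀ i : Fin 3, 4 * ∫⁻ x : E3, ENNReal.ofReal (x i ^ 2 * W x ^ 6) =
      12 * ∫⁻ x, ENNReal.ofReal (gradSqR W x) := fun i => by
    rw [← lintegral_W_coord i, lintegral_W_pow_four, ← mul_assoc]; norm_num
  set K := ∫⁻ x, ENNReal.ofReal (gradSqR W x)
  have hK : K ≠ ∞ := by
    have := integrable_gradSqR_W.lintegral_lt_top
    exact this.ne
  have key2 := mul_le_mul_right key 2
  have e1 : ∀ a b c d : ℝ≥0∞, 2 * (18 * d + 2 * (a + (b + c))) =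
      36 * d + (4 * a + 4 * b + 4 * c) := fun a b c d => by ring
  rw [e1, hs, hs, hs] at key2
  have e2 : 2 * (9 * (4 * K)) = 36 * K + 36 * K := by ring
  have e3 : 12 * K + 12 * K + 12 * K = 36 * K := by ring
  rw [e2, e3] at key2
  have key3 := (ENNReal.add_le_add_iff_right (ENNReal.mul_ne_top (by simp) hK)).1 key2
  exact (ENNReal.mul_le_mul_iff_right (by simp) (by simp)).1 key3

lemma continuous_gradSqR {v : E3 → ℝ} (hv : ContDiff ℝ 1 v) : Continuous (gradSqR v) :=
  continuous_finsetSum _ fun i _ => (continuous_pdR hv i).pow 2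

lemma gradSqR_nonneg {v : E3 → ℝ} (x : E3) : 0 ≤ gradSqR v x :=
  Finset.sum_nonneg fun _ _ => sq_nonneg _

lemma gradSqC_nonneg {f : E3 → ℂ} (x : E3) : 0 ≤ gradSqC f x :=
  Finset.sum_nonneg fun _ _ => sq_nonneg _

lemma contDiff_one_W : ContDiff ℝ 1 W := contDiff_W.of_le (by exact_mod_cast le_top)

lemma integral_pos_of_continuous {g : E3 → ℝ} (hc : Continuous g) (h0 : ∀ x, 0 ≤ g x)
    (hi : Integrable g) {y : E3} (hy : 0 < g y) : 0 < ∫ x, g x := by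
  refine lt_of_le_of_ne (integral_nonneg h0) fun h => ?_
  have h1 := (integral_eq_zero_iff_of_nonneg h0 hi).1 h.symm
  have h2 := (hc.ae_eq_iff_eq volume continuous_zero).1 h1
  exact hy.ne' (congrFun h2 y)

lemma integral_W_pow_six_pos : 0 < ∫ x, W x ^ 6 :=
  integral_pos_of_continuous (y := 0) (contDiff_W.continuous.pow 6)
    (fun x => (pow_pos (W_pos x) 6).le) integrable_W_pow_six (pow_pos (W_pos 0) 6)

lemma integral_gradSqR_W_pos : 0 < ∫ x, gradSqR W x := by
  refine integral_pos_of_continuous (y := e3 0) (continuous_gradSqR contDiff_one_W)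
    gradSqR_nonneg integrable_gradSqR_W ?_
  have := W_pos (e3 0)
  rw [gradSqR_W]
  simp only [e3, PiLp.norm_single] at *
  norm_num
  positivity

lemma gradSqR_sqrt_le {f : E3 → ℂ} (hf : ContDiff ℝ 1 f) {δ θ : ℝ} (hδ : 0 < δ) (x : E3) :
    gradSqR (fun y => θ * √(‖f y‖ ^ 2 + δ * W y ^ 2)) x ≤
      θ ^ 2 * (gradSqC f x + δ * gradSqR W x) := by
  have hq : 0 < ‖f x‖ ^ 2 + δ * W x ^ 2 := by have := W_pos x; positivity
  have hF : HasFDerivAt f (fderiv ℝ f x) x := (hf.differentiable (by norm_num) x).hasFDerivAt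
  have hW : HasFDerivAt W (fderiv ℝ W x) x :=
    (contDiff_one_W.differentiable (by norm_num) x).hasFDerivAt
  have h := ((hF.norm_sq.fun_add ((hW.pow 2).const_mul δ)).sqrt hq.ne').const_mul θ
  have hp : ∀ i, pdR i (fun y => θ * √(‖f y‖ ^ 2 + δ * W y ^ 2)) x ^ 2 ≤
      θ ^ 2 * (‖pdC i f x‖ ^ 2 + δ * pdR i W x ^ 2) := by
    intro i
    have e : pdR i (fun y => θ * √(‖f y‖ ^ 2 + δ * W y ^ 2)) x =
        θ * ((inner ℝ (f x) (pdC i f x) + δ * (W x * pdR i W x)) /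
          √(‖f x‖ ^ 2 + δ * W x ^ 2)) := by
      unfold pdR pdC
      rw [h.fderiv]
      simp
      field_simp
    rw [e, mul_pow, div_pow, Real.sq_sqrt hq.le]
    refine mul_le_mul_of_nonneg_left ?_ (sq_nonneg θ)
    rw [div_le_iff₀ hq]
    have hin := abs_real_inner_le_norm (f x) (pdC i f x)
    set a := inner ℝ (f x) (pdC i f x)
    set A := ‖f x‖
    set D := ‖pdC i f x‖
    set w := W x
    set d := pdR i W x
    have h1 : a ^ 2 ≤ A ^ 2 * D ^ 2 := by
      rw [← mul_pow]; exact sq_le_sq.2 (hin.trans (le_abs_self _))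
    have h2 : 2 * a * (w * d) ≤ A ^ 2 * d ^ 2 + D ^ 2 * w ^ 2 := by
      have h3 : a * (w * d) ≤ (A * D) * (|w| * |d|) := by
        refine (le_abs_self _).trans ?_
        rw [abs_mul, abs_mul]
        exact mul_le_mul_of_nonneg_right hin (by positivity)
      have : 0 ≤ (A * |d| - D * |w|) ^ 2 := sq_nonneg _
      rw [← sq_abs w, ← sq_abs d]
      nlinarith
    nlinarith
  unfold gradSqC gradSqR
  rw [Finset.mul_sum, ← Finset.sum_add_distrib, Finset.mul_sum]
  exact Finset.sum_le_sum fun i _ => hp i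

/-- Sharp Sobolev inequality in the form: a function decaying like `W` with the Dirichlet energy
of `W` has at most the `L⁶` mass of `W`. -/
theorem integral_norm_pow_six_le {f : E3 → ℂ} {C : ℝ} (hf : ContDiff ℝ 1 f)
    (hC : ∀ x, ‖f x‖ ≤ C * W x) (hg : Integrable (gradSqC f))
    (heq : ∫ x, gradSqC f x = ∫ x, gradSqR W x) :
    ∫ x, ‖f x‖ ^ 6 ≤ ∫ x, W x ^ 6 := by
  by_contra! hlt
  set M := ∫ x, W x ^ 6
  set N := ∫ x, ‖f x‖ ^ 6 with hN
  set K := ∫ x, gradSqR W x with hK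
  have hM0 : 0 < M := integral_W_pow_six_pos
  have hK0 : 0 < K := integral_gradSqR_W_pos
  have hN0 : 0 < N := hM0.trans hlt
  have hfc := hf.continuous
  have hWc := contDiff_W.continuous
  set τ := (M / N) ^ (1 / 3 : ℝ) with hτ
  have hτ0 : 0 ≤ τ := by positivity
  have hτ3 : τ ^ 3 = M / N := by
    rw [hτ, ← Real.rpow_natCast, ← Real.rpow_mul (by positivity)]
    norm_num
  have hτ1 : τ < 1 := by
    refine lt_of_pow_lt_pow_left₀ 3 zero_le_one ?_
    rw [hτ3, one_pow, div_lt_one hN0]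
    exact hlt
  set δ := (1 - τ) / 2 with hδ
  have hδ0 : 0 < δ := by linarith
  have hC0 : 0 ≤ C := by
    have := (norm_nonneg _).trans (hC 0)
    exact nonneg_of_mul_nonneg_left this (W_pos 0)
  set q : E3 → ℝ := fun x => ‖f x‖ ^ 2 + δ * W x ^ 2 with hq
  have hqc : Continuous q := by fun_prop
  have hq0 : ∀ x, 0 < q x := fun x => by
    have := W_pos x
    simp only [hq]; positivity
  have hqW : ∀ x, q x ^ 3 ≤ (C ^ 2 + δ) ^ 3 * W x ^ 6 := fun x => by
    have : q x ≤ (C ^ 2 + δ) * W x ^ 2 := by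
      have := pow_le_pow_left₀ (norm_nonneg _) (hC x) 2
      simp only [hq]; nlinarith
    calc q x ^ 3 ≤ ((C ^ 2 + δ) * W x ^ 2) ^ 3 := pow_le_pow_left₀ (hq0 x).le this 3
      _ = _ := by ring
  have hqi : Integrable fun x => q x ^ 3 :=
    (integrable_W_pow_six.const_mul _).mono' (hqc.pow 3).aestronglyMeasurable
      (Eventually.of_forall fun x => by
        rw [Real.norm_of_nonneg (pow_pos (hq0 x) 3).le]; exact hqW x)
  have hfq : ∀ x, ‖f x‖ ^ 6 ≤ q x ^ 3 := fun x => by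
    have : ‖f x‖ ^ 2 ≤ q x := by have := W_pos x; simp only [hq]; nlinarith [mul_pos hδ0 (pow_pos this 2)]
    calc ‖f x‖ ^ 6 = (‖f x‖ ^ 2) ^ 3 := by ring
      _ ≤ _ := pow_le_pow_left₀ (by positivity) this 3
  have hfi : Integrable fun x => ‖f x‖ ^ 6 :=
    hqi.mono' (hfc.norm.pow 6).aestronglyMeasurable
      (Eventually.of_forall fun x => by
        rw [Real.norm_of_nonneg (by positivity)]; exact hfq x)
  set P := ∫ x, q x ^ 3 with hP
  have hNP : N ≤ P := integral_mono hfi hqi hfq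
  have hP0 : 0 < P := hN0.trans_le hNP
  set θ := (M / P) ^ (1 / 6 : ℝ) with hθ
  have hθ0 : 0 < θ := by positivity
  have hθ6 : θ ^ 6 = M / P := by
    rw [hθ, ← Real.rpow_natCast, ← Real.rpow_mul (by positivity)]
    norm_num
  have hθτ : θ ^ 2 ≤ τ := by
    refine le_of_pow_le_pow_left₀ (n := 3) (by norm_num) hτ0 ?_
    rw [hτ3, ← pow_mul, hθ6]
    exact div_le_div_of_nonneg_left hM0.le hN0 hNP
  have hgr : ∀ x, gradSqR (fun y => θ * √(q y)) x ≤ θ ^ 2 * (gradSqC f x + δ * gradSqR W x) :=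
    fun x => gradSqR_sqrt_le hf hδ0 x
  clear_value θ τ δ q P
  have hv6 : ∀ x, (θ * √(q x)) ^ 6 = M / P * q x ^ 3 := fun x => by
    rw [mul_pow, hθ6, show √(q x) ^ 6 = (√(q x) ^ 2) ^ 3 by ring, Real.sq_sqrt (hq0 x).le]
  have hv : ContDiff ℝ 1 fun x => θ * √(q x) := by
    refine contDiff_const.mul (ContDiff.sqrt ?_ fun x => (hq0 x).ne')
    rw [hq]
    exact (hf.norm_sq ℝ).add (contDiff_const.mul (contDiff_one_W.pow 2))
  have key := sobolev_of_eq_mass (v := fun x => θ * √(q x)) (C := M / P * (C ^ 2 + δ) ^ 3) hv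
    (fun x => mul_pos hθ0 (Real.sqrt_pos.2 (hq0 x)))
    (fun x => by
      rw [hv6, mul_assoc]
      exact mul_le_mul_of_nonneg_left (hqW x) (by positivity))
    (by
      simp_rw [hv6]
      rw [lintegral_eq_ofReal_integral (hqi.const_mul _)
          fun x => by have := hq0 x; positivity,
        lintegral_eq_ofReal_integral integrable_W_pow_six fun x => (pow_pos (W_pos x) 6).le,
        integral_const_mul, ← hP, div_mul_cancel₀ _ hP0.ne'])
  have hri : Integrable fun x => θ ^ 2 * (gradSqC f x + δ * gradSqR W x) :=
    (hg.add (integrable_gradSqR_W.const_mul δ)).const_mul _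
  have key2 := key.trans (lintegral_mono fun x =>
    ENNReal.ofReal_le_ofReal (hgr x))
  rw [lintegral_eq_ofReal_integral integrable_gradSqR_W
      gradSqR_nonneg,
    lintegral_eq_ofReal_integral hri fun x => mul_nonneg (sq_nonneg _) (add_nonneg
      (gradSqC_nonneg x) (mul_nonneg hδ0.le (gradSqR_nonneg x))), integral_const_mul,
    integral_add hg (integrable_gradSqR_W.const_mul δ), integral_const_mul, heq, ← hK,
    ENNReal.ofReal_le_ofReal_iff (by positivity)] at key2
  have : θ ^ 2 * (K + δ * K) ≤ τ * (K + δ * K) :=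
    mul_le_mul_of_nonneg_right hθτ (by positivity)
  have h3 : τ * (1 + δ) < 1 := by nlinarith
  nlinarith

/-- An integrable weight on `ℝ³`, bounded by `1`. -/
def spaceWeight (x : E3) : ℝ := ((1 + ‖x‖) ^ 4)⁻¹

lemma spaceWeight_pos (x : E3) : 0 < spaceWeight x := by unfold spaceWeight; positivity

lemma spaceWeight_le_one (x : E3) : spaceWeight x ≤ 1 := by
  unfold spaceWeight
  exact inv_le_one_of_one_le₀ (one_le_pow₀ (by linarith [norm_nonneg x]))

lemma spaceWeight_le_W (x : E3) : spaceWeight x ≤ W x := by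
  refine le_of_pow_le_pow_left₀ (n := 2) (by norm_num) (W_pos x).le ?_
  have h := norm_nonneg x
  calc spaceWeight x ^ 2 ≤ spaceWeight x := by
        nlinarith [spaceWeight_pos x, spaceWeight_le_one x]
    _ ≤ (1 + ‖x‖ ^ 2 / 3)⁻¹ := by
        unfold spaceWeight
        refine inv_anti₀ (by positivity) ?_
        nlinarith [pow_nonneg h 2, pow_nonneg h 3, pow_nonneg h 4]
    _ = W x ^ 2 := (W_sq x).symm

lemma integrable_spaceWeight : Integrable spaceWeight := by
  refine (integrable_one_add_norm (E := E3) (μ := volume) (r := 4) (by simp; norm_num)).congr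
    (Eventually.of_forall fun x => ?_)
  have h : 0 ≤ 1 + ‖x‖ := by positivity
  simp only [spaceWeight]
  rw [Real.rpow_neg h]
  norm_cast

/-- `f` is `C²` and it and its pure derivatives of order at most two are bounded by `D` times the
weight. -/
structure WeightBound (D : ℝ) (f : E3 → ℂ) : Prop where
  smooth : ContDiff ℝ 2 f
  nonneg : 0 ≤ D
  zero : ∀ x, ‖f x‖ ≤ D * spaceWeight x
  one : ∀ i x, ‖pdC i f x‖ ≤ D * spaceWeight x
  two : ∀ i x, ‖pdC i (pdC i f) x‖ ≤ D * spaceWeight x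

namespace WeightBound

variable {D D' : ℝ} {f g : E3 → ℂ}

lemma contDiff_pdC (hf : ContDiff ℝ 2 f) (i : Fin 3) : ContDiff ℝ 1 (pdC i f) :=
  (hf.fderiv_right (m := 1) (by norm_num)).clm_apply contDiff_const

lemma continuous_pdC_pdC (hf : ContDiff ℝ 2 f) (i : Fin 3) : Continuous (pdC i (pdC i f)) :=
  ((contDiff_pdC hf i).continuous_fderiv (by norm_num)).clm_apply continuous_const

lemma continuous_lapC (hf : ContDiff ℝ 2 f) : Continuous (lapC f) :=
  continuous_finsetSum _ fun i _ => continuous_pdC_pdC hf i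

lemma continuous_gradSqC (hf : ContDiff ℝ 2 f) : Continuous (gradSqC f) :=
  continuous_finsetSum _ fun i _ => (contDiff_pdC hf i).continuous.norm.pow 2

lemma le_const {D a : ℝ} {x : E3} (hD : 0 ≤ D) (h : a ≤ D * spaceWeight x) : a ≤ D :=
  h.trans (mul_le_of_le_one_right hD (spaceWeight_le_one x))

lemma norm_le (hf : WeightBound D f) (x : E3) : ‖f x‖ ≤ D := le_const hf.nonneg (hf.zero x)

lemma lapC_le (hf : WeightBound D f) (x : E3) : ‖lapC f x‖ ≤ 3 * D * spaceWeight x := by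
  unfold lapC
  refine (norm_sum_le _ _).trans ?_
  rw [Fin.sum_univ_three]
  linarith [hf.two 0 x, hf.two 1 x, hf.two 2 x]

lemma gradSqC_le (hf : WeightBound D f) (x : E3) : gradSqC f x ≤ 3 * D ^ 2 * spaceWeight x := by
  have h : ∀ i, ‖pdC i f x‖ ^ 2 ≤ D ^ 2 * spaceWeight x := fun i => by
    have h1 := hf.one i x
    have h2 := le_const hf.nonneg h1
    rw [sq, sq, mul_assoc]
    exact mul_le_mul h2 h1 (norm_nonneg _) hf.nonneg
  unfold gradSqC
  rw [Fin.sum_univ_three]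
  linarith [h 0, h 1, h 2]

lemma norm_pow_le (hf : WeightBound D f) (n : ℕ) (x : E3) :
    ‖f x‖ ^ (n + 1) ≤ D ^ (n + 1) * spaceWeight x := by
  rw [pow_succ, pow_succ, mul_assoc]
  exact mul_le_mul (pow_le_pow_left₀ (norm_nonneg _) (hf.norm_le x) n) (hf.zero x)
    (norm_nonneg _) (pow_nonneg hf.nonneg n)

lemma integrable_gradSqC (hf : WeightBound D f) : Integrable (gradSqC f) :=
  (integrable_spaceWeight.const_mul _).mono' (continuous_gradSqC hf.smooth).aestronglyMeasurable
    (Eventually.of_forall fun x => by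
      rw [Real.norm_of_nonneg (gradSqC_nonneg x)]; exact hf.gradSqC_le x)

lemma integrable_norm_pow (hf : WeightBound D f) (n : ℕ) :
    Integrable fun x => ‖f x‖ ^ (n + 1) :=
  (integrable_spaceWeight.const_mul _).mono'
    (hf.smooth.continuous.norm.pow _).aestronglyMeasurable
    (Eventually.of_forall fun x => by
      rw [Real.norm_of_nonneg (by positivity)]; exact hf.norm_pow_le n x)

lemma Ecq_eq (hf : WeightBound D f) :
    Ecq f = 1 / 2 * (∫ x, gradSqC f x) - 1 / 6 * (∫ x, ‖f x‖ ^ 6) + 1 / 4 * ∫ x, ‖f x‖ ^ 4 := by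
  have h1 := hf.integrable_gradSqC.const_mul (1 / 2 : ℝ)
  have h2 := (hf.integrable_norm_pow 5).const_mul (1 / 6 : ℝ)
  have h3 := (hf.integrable_norm_pow 3).const_mul (1 / 4 : ℝ)
  norm_num only [Nat.reduceAdd] at h2 h3
  have h12 : Integrable fun x => (1 / 2 : ℝ) * gradSqC f x - 1 / 6 * ‖f x‖ ^ 6 := h1.sub h2
  unfold Ecq
  rw [integral_add h12 h3, integral_sub h1 h2, integral_const_mul, integral_const_mul,
    integral_const_mul]

lemma pdC_add (hf : ContDiff ℝ 2 f) (hg : ContDiff ℝ 2 g) (i : Fin 3) :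
    pdC i (f + g) = pdC i f + pdC i g := by
  funext x
  simp only [pdC, Pi.add_apply]
  rw [fderiv_add (hf.differentiable (by norm_num) x) (hg.differentiable (by norm_num) x)]
  rfl

lemma pdC_pdC_add (hf : ContDiff ℝ 2 f) (hg : ContDiff ℝ 2 g) (i : Fin 3) :
    pdC i (pdC i (f + g)) = pdC i (pdC i f) + pdC i (pdC i g) := by
  rw [pdC_add hf hg]
  funext x
  simp only [Pi.add_apply]
  rw [pdC, fderiv_add ((contDiff_pdC hf i).differentiable (by norm_num) x)
    ((contDiff_pdC hg i).differentiable (by norm_num) x)]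
  rfl

lemma pdC_neg (i : Fin 3) : pdC i (-f) = -pdC i f := by
  funext x
  simp [pdC, fderiv_neg]

lemma add (hf : WeightBound D f) (hg : WeightBound D' g) : WeightBound (D + D') (f + g) := by
  refine ⟨hf.smooth.add hg.smooth, add_nonneg hf.nonneg hg.nonneg, fun x => ?_, fun i x => ?_,
    fun i x => ?_⟩
  · exact (norm_add_le _ _).trans (by linarith [hf.zero x, hg.zero x])
  · rw [pdC_add hf.smooth hg.smooth]
    exact (norm_add_le _ _).trans (by linarith [hf.one i x, hg.one i x])
  · rw [pdC_pdC_add hf.smooth hg.smooth]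
    exact (norm_add_le _ _).trans (by linarith [hf.two i x, hg.two i x])

lemma neg (hf : WeightBound D f) : WeightBound D (-f) := by
  refine ⟨hf.smooth.neg, hf.nonneg, fun x => ?_, fun i x => ?_, fun i x => ?_⟩
  · simpa using hf.zero x
  · rw [pdC_neg]; simpa using hf.one i x
  · rw [pdC_neg, pdC_neg]; simpa using hf.two i x

lemma integral_inner_pdC (hf : WeightBound D f) (hg : WeightBound D' g) (i : Fin 3) :
    Integrable (fun x => inner ℝ (pdC i (pdC i f) x) (g x)) ∧
    ∫ x, inner ℝ (pdC i f x) (pdC i g x) = -∫ x, inner ℝ (pdC i (pdC i f) x) (g x) := by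
  have hi : ∀ {a b : E3 → ℂ}, Continuous a → Continuous b → (∀ x, ‖a x‖ ≤ D * spaceWeight x) →
      (∀ x, ‖b x‖ ≤ D' * spaceWeight x) → Integrable fun x => inner ℝ (a x) (b x) := by
    intro a b ha hb hab hbb
    refine (integrable_spaceWeight.const_mul (D * D')).mono'
      (ha.inner hb).aestronglyMeasurable (Eventually.of_forall fun x => ?_)
    refine (norm_inner_le_norm _ _).trans ?_
    rw [mul_comm D, mul_assoc, mul_comm]
    have := le_const hg.nonneg (hbb x)
    exact mul_le_mul this (hab x) (norm_nonneg _) hg.nonneg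
  have c1 := contDiff_pdC hf.smooth i
  have c2 := contDiff_pdC hg.smooth i
  have i1 := hi (continuous_pdC_pdC hf.smooth i) hg.smooth.continuous (hf.two i) hg.zero
  refine ⟨i1, ?_⟩
  exact integral_bilinear_fderiv_right_eq_neg_left_of_integrable (B := innerSL ℝ (E := ℂ))
    (f := pdC i f) (g := g) (v := e3 i) i1
    (hi c1.continuous c2.continuous (hf.one i) (hg.one i))
    (hi c1.continuous hg.smooth.continuous (hf.one i) hg.zero)
    (fun x _ => c1.differentiable (by norm_num) x)
    (fun x _ => hg.smooth.differentiable (by norm_num) x)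

lemma integral_gradSqC_sub (hf : WeightBound D f) (hg : WeightBound D' g) :
    Integrable (fun x => inner ℝ (lapC f x + lapC g x) (f x - g x)) ∧
    (∫ x, gradSqC f x) - ∫ x, gradSqC g x =
      -∫ x, inner ℝ (lapC f x + lapC g x) (f x - g x) := by
  have hs := hf.add hg
  have hd := hf.add hg.neg
  have h := fun i => integral_inner_pdC hs hd i
  have e1 : ∀ x, gradSqC f x - gradSqC g x =
      ∑ i, inner ℝ (pdC i (f + g) x) (pdC i (f + -g) x) := fun x => by
    unfold gradSqC
    rw [← Finset.sum_sub_distrib]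
    refine Finset.sum_congr rfl fun i _ => ?_
    rw [pdC_add hf.smooth hg.smooth, pdC_add hf.smooth hg.neg.smooth, pdC_neg]
    simp only [Pi.add_apply, Pi.neg_apply, ← sub_eq_add_neg]
    rw [inner_add_left, inner_sub_right, inner_sub_right, real_inner_self_eq_norm_sq,
      real_inner_self_eq_norm_sq, real_inner_comm]
    ring
  have e2 : ∀ x, inner ℝ (lapC f x + lapC g x) (f x - g x) =
      ∑ i, inner ℝ (pdC i (pdC i (f + g)) x) ((f + -g) x) := fun x => by
    unfold lapC
    rw [← Finset.sum_add_distrib, sum_inner]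
    refine Finset.sum_congr rfl fun i _ => ?_
    rw [pdC_pdC_add hf.smooth hg.smooth]
    simp [sub_eq_add_neg]
  have hi : ∀ i, Integrable fun x => inner ℝ (pdC i (f + g) x) (pdC i (f + -g) x) := fun i => by
    refine (integrable_spaceWeight.const_mul ((D + D') * (D + D'))).mono'
      ((contDiff_pdC hs.smooth i).continuous.inner
        (contDiff_pdC hd.smooth i).continuous).aestronglyMeasurable
      (Eventually.of_forall fun x => ?_)
    refine (norm_inner_le_norm _ _).trans ?_
    rw [mul_assoc]
    exact mul_le_mul (le_const hs.nonneg (hs.one i x)) (hd.one i x) (norm_nonneg _) hs.nonneg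
  simp_rw [e2]
  refine ⟨integrable_finsetSum _ fun i _ => (h i).1, ?_⟩
  rw [← integral_sub hf.integrable_gradSqC hg.integrable_gradSqC, integral_congr_ae
    (Eventually.of_forall e1), integral_finsetSum _ fun i _ => hi i,
    integral_finsetSum _ fun i _ => (h i).1, ← Finset.sum_neg_distrib]
  exact Finset.sum_congr rfl fun i _ => (h i).2

lemma Ecq_sub (hf : WeightBound D f) (hg : WeightBound D' g) :
    Ecq f - Ecq g = ∫ x, (-(1 / 2) * inner ℝ (lapC f x + lapC g x) (f x - g x) -
      1 / 6 * (‖f x‖ ^ 6 - ‖g x‖ ^ 6) + 1 / 4 * (‖f x‖ ^ 4 - ‖g x‖ ^ 4)) := by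
  obtain ⟨hi, hI⟩ := integral_gradSqC_sub hf hg
  have f6 := hf.integrable_norm_pow 5
  have f4 := hf.integrable_norm_pow 3
  have g6 := hg.integrable_norm_pow 5
  have g4 := hg.integrable_norm_pow 3
  norm_num only [Nat.reduceAdd] at f6 f4 g6 g4
  have j1 := hi.const_mul (-(1 / 2) : ℝ)
  have j2 : Integrable fun x => (1 / 6 : ℝ) * (‖f x‖ ^ 6 - ‖g x‖ ^ 6) := (f6.sub g6).const_mul _
  have j3 : Integrable fun x => (1 / 4 : ℝ) * (‖f x‖ ^ 4 - ‖g x‖ ^ 4) := (f4.sub g4).const_mul _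
  have j4 : Integrable fun x => -(1 / 2) * inner ℝ (lapC f x + lapC g x) (f x - g x) -
      1 / 6 * (‖f x‖ ^ 6 - ‖g x‖ ^ 6) := j1.sub j2
  rw [integral_add j4 j3, integral_sub j1 j2, integral_const_mul, integral_const_mul,
    integral_const_mul, integral_sub f6 g6, integral_sub f4 g4, hf.Ecq_eq, hg.Ecq_eq]
  linarith

end WeightBound

lemma norm_e3 (i : Fin 3) : ‖e3 i‖ = 1 := by simp [e3, PiLp.norm_single]

lemma norm_pdC_le (f : E3 → ℂ) (i : Fin 3) (x : E3) :
    ‖pdC i f x‖ ≤ ‖iteratedFDeriv ℝ 1 f x‖ := by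
  rw [norm_iteratedFDeriv_one]
  refine ((fderiv ℝ f x).le_opNorm _).trans ?_
  rw [norm_e3, mul_one]

lemma norm_pdC_pdC_le {f : E3 → ℂ} (hf : ContDiff ℝ 2 f) (i : Fin 3) (x : E3) :
    ‖pdC i (pdC i f) x‖ ≤ ‖iteratedFDeriv ℝ 2 f x‖ := by
  have hd : DifferentiableAt ℝ (fderiv ℝ f) x :=
    (hf.fderiv_right (m := 1) (by norm_num)).differentiable (by norm_num) x
  have e : pdC i (pdC i f) x = (fderiv ℝ (fderiv ℝ f) x (e3 i)) (e3 i) := by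
    have h := hd.hasFDerivAt.clm_apply (hasFDerivAt_const (e3 i) x)
    unfold pdC
    rw [h.fderiv]
    simp
  rw [e, ← norm_iteratedFDeriv_fderiv (n := 1), norm_iteratedFDeriv_one]
  refine (ContinuousLinearMap.le_opNorm₂ _ _ _).trans ?_
  rw [norm_e3, mul_one, mul_one]

lemma IsRegularSolution.mono {I J : Set ℝ} {u : ℝ → E3 → ℂ} (hu : IsRegularSolution I u)
    (h : J ⊆ I) : IsRegularSolution J u :=
  ⟨hu.1.mono (Set.prod_mono h le_rfl), fun t ht x => hu.2.1 t (h ht) x,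
    fun K hK hKJ n k => hu.2.2 K hK (hKJ.trans h) n k⟩

lemma contDiff_slice {J : Set ℝ} {F : ℝ × E3 → ℂ} (hF : ContDiffOn ℝ (⊤ : ℕ∞) F (J ×ˢ Set.univ))
    {t : ℝ} (ht : t ∈ J) : ContDiff ℝ (⊤ : ℕ∞) fun x => F (t, x) := by
  rw [← contDiffOn_univ]
  exact hF.comp (contDiff_const.prodMk contDiff_id).contDiffOn fun x _ => ⟨ht, trivial⟩

lemma exists_slice_pdC {a b : ℝ} (hab : a < b) {F : ℝ × E3 → ℂ}
    (hF : ContDiffOn ℝ (⊤ : ℕ∞) F (Set.Icc a b ×ˢ Set.univ)) (i : Fin 3) :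
    ∃ F' : ℝ × E3 → ℂ, ContDiffOn ℝ (⊤ : ℕ∞) F' (Set.Icc a b ×ˢ Set.univ) ∧
      ∀ t ∈ Set.Icc a b, pdC i (fun x => F (t, x)) = fun x => F' (t, x) := by
  have hU : UniqueDiffOn ℝ (Set.Icc a b ×ˢ (Set.univ : Set E3)) :=
    (uniqueDiffOn_Icc hab).prod uniqueDiffOn_univ
  refine ⟨fun p => fderivWithin ℝ F (Set.Icc a b ×ˢ Set.univ) p (0, e3 i),
    (hF.fderivWithin hU (by simp)).clm_apply contDiffOn_const, fun t ht => funext fun x => ?_⟩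
  have h1 := ((hF.differentiableOn (by simp)) (t, x) ⟨ht, trivial⟩).hasFDerivWithinAt
  have h2 : HasFDerivWithinAt (fun y : E3 => (t, y)) (ContinuousLinearMap.inr ℝ ℝ E3)
      Set.univ x := (hasFDerivAt_prodMk_right t x).hasFDerivWithinAt
  have h3 := (h1.comp x h2 fun y _ => ⟨ht, trivial⟩).hasFDerivAt_of_univ
  unfold pdC
  rw [show (fun x => F (t, x)) = F ∘ fun y => (t, y) from rfl, h3.fderiv]
  simp

lemma continuousOn_time {J : Set ℝ} {F : ℝ × E3 → ℂ}
    (hF : ContDiffOn ℝ (⊤ : ℕ∞) F (J ×ˢ Set.univ)) (x : E3) :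
    ContinuousOn (fun t => F (t, x)) J :=
  hF.continuousOn.comp (by fun_prop) fun _ ht => ⟨ht, trivial⟩

namespace IsRegularSolution

variable {a b : ℝ} {u : ℝ → E3 → ℂ}

lemma exists_weightBound (hu : IsRegularSolution (Set.Icc a b) u) :
    ∃ D, ∀ t ∈ Set.Icc a b, WeightBound D (u t) := by
  obtain ⟨C0, h0⟩ := hu.2.2 _ isCompact_Icc le_rfl 4 0
  obtain ⟨C1, h1⟩ := hu.2.2 _ isCompact_Icc le_rfl 4 1
  obtain ⟨C2, h2⟩ := hu.2.2 _ isCompact_Icc le_rfl 4 2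
  set D := max 0 (max C0 (max C1 C2)) with hD
  have l0 : C0 ≤ D := by simp [hD]
  have l1 : C1 ≤ D := by simp [hD]
  have l2 : C2 ≤ D := by simp [hD]
  have key : ∀ {y C : ℝ} {x : E3}, (1 + ‖x‖) ^ 4 * y ≤ C → C ≤ D → y ≤ D * spaceWeight x := by
    intro y C x h hC
    unfold spaceWeight
    rw [← div_eq_mul_inv, le_div_iff₀ (by positivity)]
    linarith
  refine ⟨D, fun t ht => ?_⟩
  have hs : ContDiff ℝ 2 (u t) :=
    contDiff_infty.1 (contDiff_slice hu.1 ht) 2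
  refine ⟨hs, le_max_left _ _, fun x => ?_, fun i x => ?_, fun i x => ?_⟩
  · refine key (C := C0) ?_ l0
    simpa using h0 t ht x
  · exact (norm_pdC_le _ i x).trans (key (h1 t ht x) l1)
  · exact (norm_pdC_pdC_le hs i x).trans (key (h2 t ht x) l2)

lemma continuousOn_gradSqC (hab : a < b) (hu : IsRegularSolution (Set.Icc a b) u) (x : E3) :
    ContinuousOn (fun t => gradSqC (u t) x) (Set.Icc a b) := by
  unfold gradSqC
  refine continuousOn_finsetSum _ fun i _ => ?_
  obtain ⟨F, hF, h⟩ := exists_slice_pdC hab hu.1 i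
  refine ((continuousOn_time hF x).norm.pow 2).congr fun t ht => ?_
  simp only [Pi.pow_apply]
  rw [← congrFun (h t ht) x]

lemma continuousOn_lapC (hab : a < b) (hu : IsRegularSolution (Set.Icc a b) u) (x : E3) :
    ContinuousOn (fun t => lapC (u t) x) (Set.Icc a b) := by
  unfold lapC
  refine continuousOn_finsetSum _ fun i _ => ?_
  obtain ⟨F, hF, h⟩ := exists_slice_pdC hab hu.1 i
  obtain ⟨F', hF', h'⟩ := exists_slice_pdC hab hF i
  refine (continuousOn_time hF' x).congr fun t ht => ?_
  have e := h t ht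
  simp only [] at e
  rw [e, h' t ht]

lemma continuousOn_integral_gradSqC (hab : a < b) (hu : IsRegularSolution (Set.Icc a b) u) :
    ContinuousOn (fun t => ∫ x, gradSqC (u t) x) (Set.Icc a b) := by
  obtain ⟨D, hD⟩ := hu.exists_weightBound
  refine continuousOn_of_dominated (bound := fun x => 3 * D ^ 2 * spaceWeight x)
    (fun t ht => (hD t ht).integrable_gradSqC.aestronglyMeasurable)
    (fun t ht => Eventually.of_forall fun x => ?_) (integrable_spaceWeight.const_mul _)
    (Eventually.of_forall (hu.continuousOn_gradSqC hab))
  rw [Real.norm_of_nonneg (gradSqC_nonneg x)]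
  exact (hD t ht).gradSqC_le x

lemma continuousOn_integral_norm_pow (hu : IsRegularSolution (Set.Icc a b) u) (n : ℕ) :
    ContinuousOn (fun t => ∫ x, ‖u t x‖ ^ (n + 1)) (Set.Icc a b) := by
  obtain ⟨D, hD⟩ := hu.exists_weightBound
  refine continuousOn_of_dominated (bound := fun x => D ^ (n + 1) * spaceWeight x)
    (fun t ht => ((hD t ht).integrable_norm_pow n).aestronglyMeasurable)
    (fun t ht => Eventually.of_forall fun x => ?_) (integrable_spaceWeight.const_mul _)
    (Eventually.of_forall fun x => (continuousOn_time hu.1 x).norm.pow _)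
  rw [Real.norm_of_nonneg (by positivity)]
  exact (hD t ht).norm_pow_le n x

lemma continuousOn_Ecq (hab : a < b) (hu : IsRegularSolution (Set.Icc a b) u) :
    ContinuousOn (fun t => Ecq (u t)) (Set.Icc a b) := by
  obtain ⟨D, hD⟩ := hu.exists_weightBound
  have h := ((continuousOn_const (c := (1 / 2 : ℝ))).mul
    (hu.continuousOn_integral_gradSqC hab)).sub ((continuousOn_const (c := (1 / 6 : ℝ))).mul
    (hu.continuousOn_integral_norm_pow 5)) |>.add ((continuousOn_const (c := (1 / 4 : ℝ))).mul
    (hu.continuousOn_integral_norm_pow 3))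
  exact h.congr fun t ht => (hD t ht).Ecq_eq

lemma hasDerivAt_time (hu : IsRegularSolution (Set.Icc a b) u) {t : ℝ} (ht : t ∈ Set.Ioo a b)
    (x : E3) : HasDerivAt (fun s => u s x) (deriv (fun s => u s x) t) t := by
  have hn : Set.Icc a b ×ˢ (Set.univ : Set E3) ∈ 𝓝 (t, x) :=
    prod_mem_nhds (Icc_mem_nhds ht.1 ht.2) univ_mem
  have h1 : DifferentiableAt ℝ (fun p : ℝ × E3 => u p.1 p.2) (t, x) :=
    (hu.1.contDiffAt hn).differentiableAt (by simp)
  exact (h1.comp t (by fun_prop : DifferentiableAt ℝ (fun s : ℝ => (s, x)) t)).hasDerivAt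

lemma norm_deriv_le {D : ℝ} (hu : IsRegularSolution (Set.Icc a b) u)
    (hD : ∀ t ∈ Set.Icc a b, WeightBound D (u t)) {t : ℝ} (ht : t ∈ Set.Icc a b) (x : E3) :
    ‖deriv (fun s => u s x) t‖ ≤ (3 * D + D ^ 3 + D ^ 5) * spaceWeight x := by
  have h := hu.2.1 t ht x
  have e : Complex.I * deriv (fun s => u s x) t =
      (‖u t x‖ : ℂ) ^ 2 * u t x - (‖u t x‖ : ℂ) ^ 4 * u t x - lapC (u t) x := by
    linear_combination h
  have h1 := congrArg norm e
  rw [norm_mul, Complex.norm_I, one_mul] at h1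
  rw [h1]
  refine (norm_sub_le _ _).trans ((add_le_add_left (norm_sub_le _ _) _).trans ?_)
  simp only [norm_mul, norm_pow, Complex.norm_real, norm_norm]
  have b1 := (hD t ht).lapC_le x
  have b2 := (hD t ht).norm_pow_le 2 x
  have b3 := (hD t ht).norm_pow_le 4 x
  simp only [Nat.reduceAdd, pow_succ _ 2, pow_succ _ 4] at b2 b3
  nlinarith

lemma norm_sub_le_time {D : ℝ} (hu : IsRegularSolution (Set.Icc a b) u)
    (hD : ∀ t ∈ Set.Icc a b, WeightBound D (u t)) {s t : ℝ} (hs : s ∈ Set.Ioo a b)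
    (ht : t ∈ Set.Ioo a b) (x : E3) :
    ‖u t x - u s x‖ ≤ (3 * D + D ^ 3 + D ^ 5) * spaceWeight x * |t - s| :=
  (convex_Ioo a b).norm_image_sub_le_of_norm_deriv_le
    (fun _ hr => (hu.hasDerivAt_time hr x).differentiableAt)
    (fun _ hr => hu.norm_deriv_le hD (Set.Ioo_subset_Icc_self hr) x) hs ht

end IsRegularSolution

/-- Integrand of the energy difference `E(f) - E(g)` after integration by parts. -/
def energyDiff (f g : E3 → ℂ) (x : E3) : ℝ :=
  -(1 / 2) * inner ℝ (lapC f x + lapC g x) (f x - g x) -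
    1 / 6 * (‖f x‖ ^ 6 - ‖g x‖ ^ 6) + 1 / 4 * (‖f x‖ ^ 4 - ‖g x‖ ^ 4)

lemma abs_energyDiff_le {D : ℝ} {f g : E3 → ℂ} (hf : WeightBound D f) (hg : WeightBound D g)
    (x : E3) : |energyDiff f g x| ≤ (3 * D + D ^ 3 + D ^ 5) * ‖f x - g x‖ := by
  have hD := hf.nonneg
  have hl : ‖lapC f x + lapC g x‖ ≤ 6 * D := by
    have h : ∀ {h : E3 → ℂ}, WeightBound D h → ‖lapC h x‖ ≤ 3 * D := fun hh =>
      (hh.lapC_le x).trans (mul_le_of_le_one_right (by positivity) (spaceWeight_le_one x))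
    exact (norm_add_le _ _).trans (by linarith [h hf, h hg])
  have h1 : |inner ℝ (lapC f x + lapC g x) (f x - g x)| ≤ 6 * D * ‖f x - g x‖ :=
    (abs_real_inner_le_norm _ _).trans (mul_le_mul_of_nonneg_right hl (norm_nonneg _))
  have hp : ∀ n : ℕ, |‖f x‖ ^ n - ‖g x‖ ^ n| ≤ ‖f x - g x‖ * n * D ^ (n - 1) := fun n => by
    refine (abs_pow_sub_pow_le _ _ n).trans ?_
    have hm : max |‖f x‖| |‖g x‖| ≤ D := by
      rw [abs_norm, abs_norm]; exact max_le (hf.norm_le x) (hg.norm_le x)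
    have := abs_norm_sub_norm_le (f x) (g x)
    gcongr
  have h6 := hp 6
  have h4 := hp 4
  norm_num at h6 h4
  rw [abs_le] at *
  unfold energyDiff
  constructor <;> nlinarith

lemma tendsto_energyDiff {v : ℝ → E3 → ℂ} {s : ℝ} {x : E3} {w : ℂ}
    (hv : HasDerivAt (fun t => v t x) w s)
    (hl : Tendsto (fun t => lapC (v t) x) (𝓝 s) (𝓝 (lapC (v s) x)))
    (heq : Complex.I * w + lapC (v s) x =
      (‖v s x‖ : ℂ) ^ 2 * v s x - (‖v s x‖ : ℂ) ^ 4 * v s x) :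
    Tendsto (fun t => (t - s)⁻¹ * energyDiff (v t) (v s) x) (𝓝[≠] s) (𝓝 0) := by
  have hsl := hasDerivAt_iff_tendsto_slope.1 hv
  have h2 := hv.norm_sq
  have h4 := hasDerivAt_iff_tendsto_slope.1 (h2.fun_pow 2)
  have h6 := hasDerivAt_iff_tendsto_slope.1 (h2.fun_pow 3)
  have hl' := (hl.mono_left (nhdsWithin_le_nhds (s := {s}ᶜ))).add_const (lapC (v s) x)
  have key := (((hl'.inner hsl).const_mul (-(1 / 2) : ℝ)).sub (h6.const_mul (1 / 6 : ℝ))).add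
    (h4.const_mul (1 / 4 : ℝ))
  have e0 : -(1 / 2) * inner ℝ (lapC (v s) x + lapC (v s) x) w -
      1 / 6 * (↑(3 : ℕ) * (‖v s x‖ ^ 2) ^ (3 - 1) * (2 * inner ℝ (v s x) w)) +
      1 / 4 * (↑(2 : ℕ) * (‖v s x‖ ^ 2) ^ (2 - 1) * (2 * inner ℝ (v s x) w)) = 0 := by
    have hL : lapC (v s) x =
        ((‖v s x‖ ^ 2 - ‖v s x‖ ^ 4 : ℝ) : ℂ) * v s x - Complex.I * w := by
      push_cast
      linear_combination heq
    rw [hL]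
    simp only [Complex.inner, map_add, map_sub, map_mul, Complex.conj_I, Complex.conj_ofReal,
      Complex.add_re, Complex.mul_re, Complex.sub_re, Complex.sub_im, Complex.add_im,
      Complex.mul_im, Complex.neg_re, Complex.neg_im, Complex.I_re, Complex.I_im,
      Complex.ofReal_re, Complex.ofReal_im, Complex.conj_re, Complex.conj_im]
    push_cast
    ring
  rw [e0] at key
  refine key.congr fun t => ?_
  unfold energyDiff slope
  simp only [vsub_eq_sub, smul_eq_mul, inner_smul_right]
  ring

namespace IsRegularSolution

variable {a b : ℝ} {u : ℝ → E3 → ℂ}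

lemma hasDerivAt_Ecq (hab : a < b) (hu : IsRegularSolution (Set.Icc a b) u) {s : ℝ}
    (hs : s ∈ Set.Ioo a b) : HasDerivAt (fun t => Ecq (u t)) 0 s := by
  obtain ⟨D, hD⟩ := hu.exists_weightBound
  have hs' := Set.Ioo_subset_Icc_self hs
  have hD0 := (hD s hs').nonneg
  have hn : ∀ᶠ t in 𝓝[≠] s, t ∈ Set.Ioo a b := nhdsWithin_le_nhds (Ioo_mem_nhds hs.1 hs.2)
  have hn' : ∀ᶠ t in 𝓝[≠] s, t ≠ s := eventually_mem_nhdsWithin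
  rw [hasDerivAt_iff_tendsto_slope]
  have key : Tendsto (fun t => ∫ x, (t - s)⁻¹ * energyDiff (u t) (u s) x) (𝓝[≠] s)
      (𝓝 (∫ _ : E3, (0 : ℝ))) := by
    refine tendsto_integral_filter_of_dominated_convergence
      (fun x => (3 * D + D ^ 3 + D ^ 5) ^ 2 * spaceWeight x) ?_ ?_
      (integrable_spaceWeight.const_mul _) (Eventually.of_forall fun x => ?_)
    · filter_upwards [hn] with t ht
      have h1 := (hD t (Set.Ioo_subset_Icc_self ht)).smooth
      have h2 := (hD s hs').smooth
      have c1 := WeightBound.continuous_lapC h1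
      have c2 := WeightBound.continuous_lapC h2
      have c3 := h1.continuous
      have c4 := h2.continuous
      refine Continuous.aestronglyMeasurable ?_
      unfold energyDiff
      fun_prop
    · filter_upwards [hn, hn'] with t ht hts
      refine Eventually.of_forall fun x => ?_
      have h1 := abs_energyDiff_le (hD t (Set.Ioo_subset_Icc_self ht)) (hD s hs') x
      have h2 := hu.norm_sub_le_time hD hs ht x
      have h3 : 0 < |t - s| := abs_pos.2 (sub_ne_zero.2 hts)
      rw [norm_mul, norm_inv, Real.norm_eq_abs, Real.norm_eq_abs, inv_mul_le_iff₀ h3]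
      refine h1.trans ((mul_le_mul_of_nonneg_left h2 (by positivity)).trans_eq ?_)
      ring
    · refine tendsto_energyDiff (hu.hasDerivAt_time hs x) ?_ (hu.2.1 s hs' x)
      exact (hu.continuousOn_lapC hab x).continuousAt (Icc_mem_nhds hs.1 hs.2)
  rw [integral_zero] at key
  refine key.congr' ?_
  filter_upwards [hn] with t ht
  rw [integral_const_mul, slope_def_field, div_eq_inv_mul,
    (hD t (Set.Ioo_subset_Icc_self ht)).Ecq_sub (hD s hs')]
  rfl

/-- Conservation of the cubic–quintic energy. -/
theorem Ecq_eq (hab : a < b) (hu : IsRegularSolution (Set.Icc a b) u) :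
    Ecq (u a) = Ecq (u b) := by
  obtain ⟨c, -, hc⟩ := exists_hasDerivAt_eq_slope _ (fun _ => 0) hab (hu.continuousOn_Ecq hab)
    fun s hs => hu.hasDerivAt_Ecq hab hs
  rw [eq_div_iff (sub_ne_zero.2 hab.ne')] at hc
  linarith

end IsRegularSolution

lemma gradSqC_Wc (x : E3) : gradSqC Wc x = gradSqR W x := by
  unfold gradSqC gradSqR
  refine Finset.sum_congr rfl fun i _ => ?_
  have h := Complex.ofRealCLM.hasFDerivAt.comp x (hasFDerivAt_W x)
  have e : pdC i Wc x = (pdR i W x : ℂ) := by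
    unfold pdC pdR
    rw [show Wc = Complex.ofRealCLM ∘ W from rfl, h.fderiv, (hasFDerivAt_W x).fderiv]
    simp
  rw [e, Complex.norm_real, Real.norm_eq_abs, sq_abs]

lemma Ecrit_Wc : Ecrit Wc = 1 / 2 * (∫ x, gradSqR W x) - 1 / 6 * ∫ x, W x ^ 6 := by
  have e : ∀ x, ‖Wc x‖ = W x := fun x => by
    unfold Wc
    rw [Complex.norm_real, Real.norm_of_nonneg (W_pos x).le]
  unfold Ecrit
  simp_rw [e, gradSqC_Wc]
  rw [integral_sub (integrable_gradSqR_W.const_mul _) (integrable_W_pow_six.const_mul _),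
    integral_const_mul, integral_const_mul]

/-- At the threshold energy the Dirichlet energy of `W` cannot be attained. -/
theorem integral_gradSqC_ne {D : ℝ} {f : E3 → ℂ} (hf : WeightBound D f)
    (hE : Ecq f = Ecrit Wc) : ∫ x, gradSqC f x ≠ ∫ x, gradSqR W x := by
  intro h
  have h6 := integral_norm_pow_six_le (C := D) (hf.smooth.of_le (by norm_num))
    (fun x => (hf.zero x).trans (mul_le_mul_of_nonneg_left (spaceWeight_le_W x) hf.nonneg))
    hf.integrable_gradSqC h
  rw [hf.Ecq_eq, Ecrit_Wc, h] at hE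
  have h4 : ∫ x, ‖f x‖ ^ 4 ≤ 0 := by linarith
  have hz : f = 0 := by
    funext y
    by_contra hy
    have := integral_pos_of_continuous (g := fun x => ‖f x‖ ^ 4) (y := y)
      (hf.smooth.continuous.norm.pow 4) (fun x => by positivity) (hf.integrable_norm_pow 3)
      (pow_pos (norm_pos_iff.2 hy) 4)
    linarith
  have hg : ∫ x, gradSqC f x = 0 := by
    rw [hz]
    simp [gradSqC, pdC]
  linarith [integral_gradSqR_W_pos]

lemma integral_gradSqC_ne_on {I : Set ℝ} (hI : Convex ℝ I) {u : ℝ → E3 → ℂ}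
    (hu : IsRegularSolution I u) (h0 : (0 : ℝ) ∈ I) (hE : Ecq (u 0) = Ecrit Wc) {t : ℝ}
    (ht : t ∈ I) : ∫ x, gradSqC (u t) x ≠ ∫ x, gradSqR W x := by
  have key : ∀ {a b c : ℝ}, a < b → a ∈ I → b ∈ I → c ∈ Set.Icc a b → Ecq (u c) = Ecrit Wc →
      ∫ x, gradSqC (u c) x ≠ ∫ x, gradSqR W x := by
    intro a b c hab ha hb hc h
    obtain ⟨D, hD⟩ := (hu.mono (hI.ordConnected.out ha hb)).exists_weightBound
    exact integral_gradSqC_ne (hD c hc) h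
  have hsub := fun {a b : ℝ} (ha : a ∈ I) (hb : b ∈ I) => hu.mono (hI.ordConnected.out ha hb)
  rcases lt_trichotomy t 0 with h | h | h
  · exact key h ht h0 (Set.left_mem_Icc.2 h.le) (((hsub ht h0).Ecq_eq h).trans hE)
  · subst h
    have hs : IsRegularSolution (Set.Icc (0 : ℝ) 0) u := hsub h0 h0
    obtain ⟨D, hD⟩ := hs.exists_weightBound
    exact integral_gradSqC_ne (hD 0 (by simp)) hE
  · exact key h h0 ht (Set.right_mem_Icc.2 h.le) (((hsub h0 ht).Ecq_eq h).symm.trans hE)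

lemma continuousOn_integral_gradSqC_uIcc {I : Set ℝ} (hI : Convex ℝ I) {u : ℝ → E3 → ℂ}
    (hu : IsRegularSolution I u) {s t : ℝ} (hs : s ∈ I) (ht : t ∈ I) :
    ContinuousOn (fun r => ∫ x, gradSqC (u r) x) (Set.uIcc s t) := by
  have hsub := fun {a b : ℝ} (ha : a ∈ I) (hb : b ∈ I) => hu.mono (hI.ordConnected.out ha hb)
  rcases lt_trichotomy s t with h | h | h
  · rw [Set.uIcc_of_lt h]
    exact (hsub hs ht).continuousOn_integral_gradSqC h
  · subst h
    simp
  · rw [Set.uIcc_of_gt h]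
    exact (hsub ht hs).continuousOn_integral_gradSqC h

/-- Gradient norm trapping at threshold energy along the flow. -/
theorem gradient_trapping_along_flow (I : Set ℝ) (hI : Convex ℝ I) (h0 : (0:ℝ) ∈ I)
    (u : ℝ → E3 → ℂ) (hu : IsRegularSolution I u)
    (hE : Ecq (u 0) = Ecrit Wc) :
    ((∫ x : E3, gradSqC (u 0) x) < (∫ x : E3, gradSqR W x) →
      ∀ t ∈ I, (∫ x : E3, gradSqC (u t) x) < ∫ x : E3, gradSqR W x) ∧
    ((∫ x : E3, gradSqC (u 0) x) > (∫ x : E3, gradSqR W x) →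
      ∀ t ∈ I, (∫ x : E3, gradSqC (u t) x) > ∫ x : E3, gradSqR W x) := by
  have hne : ∀ t ∈ I, (∫ x, gradSqR W x) ∉
      Set.uIcc (∫ x, gradSqC (u 0) x) (∫ x, gradSqC (u t) x) := by
    intro t ht hmem
    obtain ⟨s, hs, h⟩ :=
      intermediate_value_uIcc (continuousOn_integral_gradSqC_uIcc hI hu h0 ht) hmem
    exact integral_gradSqC_ne_on hI hu h0 hE (hI.ordConnected.uIcc_subset h0 ht hs) h
  refine ⟨fun h t ht => ?_, fun h t ht => ?_⟩
  · by_contra! hle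
    exact hne t ht (Set.mem_uIcc.2 (Or.inl ⟨h.le, hle⟩))
  · by_contra! hle
    exact hne t ht (Set.mem_uIcc.2 (Or.inr ⟨hle, le_of_lt h⟩))
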